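/- arXiv:1610.02243 — 3 statements merged into one kernel-verified Lean document; each statement's English description precedes it below -/
import Mathlib

section
/- Suppose E ⊆ 𝒜 and F ⊆ ⋃_{m≥1} ℕ₀ᵐ are finite sets such that: (1) the classes of (0,0) and (1,1,1) lie in E; (2) every quiddity cycle c satisfies c ∈ E or there exists f ∈ F strictly contained in c (i.e., f ⊆ c and the length of f is strictly smaller than the length of c); (3) every f ∈ F has at least one entry equal to 1. Then E' := E ∪ δ⁻¹(ψ̄(E)) and F' := ρ⁻¹({ι(ψ(f)) : f ∈ F}) are finite sets satisfying the same three properties (1),(2),(3), and the minimal length of an element of F is strictly smaller than the minimal length of an element of F'. -/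
/-- One generating move of the dihedral action on finite sequences:
cyclic rotation by one, or reversal. -/
def dihStep (c d : List ℕ) : Prop := d = c.rotate 1 ∨ d = c.reverse

/-- The equivalence relation on finite sequences generated by cyclic
rotations and reversal (the dihedral group action). -/
def DihEquiv : List ℕ → List ℕ → Prop := Relation.EqvGen dihStep

/-- The lists that are representatives of quiddity cycles: the smallest
dihedrally closed collection containing `(0,0)` and closed under the rule
`(c₁,…,cₙ) ↦ (c₁+1, 1, c₂+1, c₃, …, cₙ)`. -/
inductive IsQuiddity : List ℕ → Prop
  | base : IsQuiddity [0, 0]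
  | dih {c d : List ℕ} : IsQuiddity c → dihStep c d → IsQuiddity d
  | grow {a b : ℕ} {t : List ℕ} : IsQuiddity (a :: b :: t) →
      IsQuiddity ((a + 1) :: 1 :: (b + 1) :: t)

/-- The (class of the) cycle `c` contains the finite sequence `d`:
some representative of `c` has `d` as a block of consecutive entries. -/
def CycContains (c d : List ℕ) : Prop := ∃ c', DihEquiv c c' ∧ d <:+: c'

/-- The setoid given by the dihedral group action on finite sequences. -/
def dihSetoid : Setoid (List ℕ) := Relation.EqvGen.setoid dihStep

/-- Classes of finite sequences modulo the dihedral action. -/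
abbrev Cyc : Type := Quotient dihSetoid

/-- The class of a finite sequence modulo the dihedral action. -/
def cyc (c : List ℕ) : Cyc := Quotient.mk dihSetoid c

/-- The set `𝒜` of quiddity cycles, as classes. -/
def QuiddityCyc : Set Cyc := {x | ∃ c, IsQuiddity c ∧ x = cyc c}

/-- The set `𝒜'` of quiddity cycles of even length whose entries equal to `1`
make up exactly half of all entries. -/
def QuiddityCyc' : Set Cyc :=
  {x | ∃ c, IsQuiddity c ∧ Even c.length ∧ c.count 1 = c.length / 2 ∧ x = cyc c}

/-- The map `ψ` on finite sequences: `(c₁,…,cₘ) ↦ (c₁+2, 1, c₂+2, 1, …, cₘ+2, 1)`. -/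
def psiL (c : List ℕ) : List ℕ := (c.map fun a => [a + 2, 1]).flatten

/-- The map `ι`: prepend an entry `1`. -/
def iotaL (c : List ℕ) : List ℕ := 1 :: c

/-- One rewriting step of the map `ρ` on finite sequences:
(a) two adjacent entries `> 1` get a `1` inserted between them and are increased;
(b) a first entry `> 1` gets a `1` prepended and is increased;
(c) a last entry `> 1` gets a `1` appended and is increased. -/
inductive rhoStep : List ℕ → List ℕ → Prop
  | mid (u v : List ℕ) (a b : ℕ) :
      rhoStep (u ++ (a + 2) :: (b + 2) :: v) (u ++ (a + 3) :: 1 :: (b + 3) :: v)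
  | head (a : ℕ) (t : List ℕ) : rhoStep ((a + 2) :: t) (1 :: (a + 3) :: t)
  | last (u : List ℕ) (a : ℕ) : rhoStep (u ++ [a + 2]) (u ++ [a + 3, 1])

/-- `ρ c = d`: iterated application of the rewriting rules starting from `c`
terminates in `d`, to which no rule applies anymore. -/
def RhoEval (c d : List ℕ) : Prop :=
  Relation.ReflTransGen rhoStep c d ∧ ∀ e, ¬ rhoStep d e

/-- One rewriting step of the map `δ` on classes: two cyclically adjacent
entries `> 1` get a `1` inserted between them and are increased. -/
def deltaStep (x y : Cyc) : Prop :=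
  ∃ a b t, x = cyc ((a + 2) :: (b + 2) :: t) ∧ y = cyc ((a + 3) :: 1 :: (b + 3) :: t)

/-- `δ x = y`: iterated application of the rewriting rule starting from `x`
terminates in `y`, to which the rule does not apply anymore. -/
def DeltaEval (x y : Cyc) : Prop :=
  Relation.ReflTransGen deltaStep x y ∧ ∀ z, ¬ deltaStep y z

/-! ### Dihedral equivalence of finite sequences -/

theorem DihEquiv.symm {c d : List ℕ} (h : DihEquiv c d) : DihEquiv d c :=
  Relation.EqvGen.symm _ _ h

theorem DihEquiv.trans {c d e : List ℕ} (h : DihEquiv c d) (h' : DihEquiv d e) : DihEquiv c e :=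
  Relation.EqvGen.trans _ _ _ h h'

theorem dihEquiv_reverse (c : List ℕ) : DihEquiv c c.reverse :=
  Relation.EqvGen.rel _ _ (Or.inr rfl)

theorem dihEquiv_rotate (c : List ℕ) (k : ℕ) : DihEquiv c (c.rotate k) := by
  induction k with
  | zero => rw [List.rotate_zero]; exact Relation.EqvGen.refl c
  | succ k ih =>
    rw [← List.rotate_rotate]
    exact ih.trans (Relation.EqvGen.rel _ _ (Or.inl rfl))

theorem dihEquiv_append_comm (u v : List ℕ) : DihEquiv (u ++ v) (v ++ u) := by
  simpa using dihEquiv_rotate (u ++ v) u.length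

theorem reflTransGen_dihStep_rotate (c : List ℕ) (k : ℕ) :
    Relation.ReflTransGen dihStep c (c.rotate k) := by
  induction k with
  | zero => rw [List.rotate_zero]
  | succ k ih => rw [← List.rotate_rotate]; exact ih.tail (Or.inl rfl)

theorem reflTransGen_dihStep_symm {c d : List ℕ} (h : dihStep c d) :
    Relation.ReflTransGen dihStep d c := by
  rcases h with rfl | rfl
  · rcases c with _ | ⟨a, t⟩
    · simpa using Relation.ReflTransGen.refl
    · have := reflTransGen_dihStep_rotate ((a :: t).rotate 1) t.length
      rwa [List.rotate_rotate, Nat.add_comm, ← List.length_cons, List.rotate_length] at this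
  · exact Relation.ReflTransGen.single (Or.inr (by simp))

theorem DihEquiv.reflTransGen {c d : List ℕ} (h : DihEquiv c d) :
    Relation.ReflTransGen dihStep c d ∧ Relation.ReflTransGen dihStep d c := by
  induction h with
  | rel _ _ h => exact ⟨.single h, reflTransGen_dihStep_symm h⟩
  | refl _ => exact ⟨.refl, .refl⟩
  | symm _ _ _ ih => exact ih.symm
  | trans _ _ _ _ _ ih ih' => exact ⟨ih.1.trans ih'.1, ih'.2.trans ih.2⟩

/-- A property of finite sequences preserved by the generating dihedral moves is invariant under
dihedral equivalence. -/
theorem DihEquiv.transport {P : List ℕ → Prop} (hP : ∀ c d, dihStep c d → P c → P d)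
    {c d : List ℕ} (h : DihEquiv c d) (hc : P c) : P d := by
  have h' := h.reflTransGen.1
  clear h
  induction h' with
  | refl => exact hc
  | tail _ h ih => exact hP _ _ h ih

theorem DihEquiv.perm {c d : List ℕ} (h : DihEquiv c d) : c.Perm d :=
  h.transport (P := fun d => c.Perm d)
    (fun c' d' h h' => h'.trans <| by
      rcases h with rfl | rfl
      · exact (List.rotate_perm c' 1).symm
      · exact (List.reverse_perm c').symm) (List.Perm.refl c)

theorem DihEquiv.exists_rotate {c d : List ℕ} (h : DihEquiv c d) :
    ∃ k, d = c.rotate k ∨ d.reverse = c.rotate k := by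
  refine h.transport (P := fun d => ∃ k, d = c.rotate k ∨ d.reverse = c.rotate k) ?_
    ⟨0, Or.inl (by simp)⟩
  rintro d e (rfl | rfl) ⟨k, rfl | hk⟩
  · exact ⟨k + 1, Or.inl (List.rotate_rotate _ _ _)⟩
  · rw [List.reverse_rotate, hk, List.rotate_rotate]
    exact ⟨_, Or.inr rfl⟩
  · exact ⟨k, Or.inr (List.reverse_reverse _)⟩
  · exact ⟨k, Or.inl hk⟩

theorem exists_rotate_eq_append {c d f : List ℕ} {k : ℕ} (hd : d = c.rotate k) (hf : f <:+: d) :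
    ∃ k g, c.rotate k = f ++ g := by
  obtain ⟨s, t, rfl⟩ := hf
  refine ⟨k + s.length, t ++ s, ?_⟩
  rw [← List.rotate_rotate, ← hd, List.append_assoc, List.rotate_append_length_eq,
    List.append_assoc]

theorem CycContains.exists_rotate_eq_append {c f : List ℕ} (h : CycContains c f) :
    ∃ k g, c.rotate k = f ++ g ∨ c.rotate k = f.reverse ++ g := by
  obtain ⟨d, hcd, hf⟩ := h
  obtain ⟨k, hk | hk⟩ := hcd.exists_rotate
  · obtain ⟨k, g, h⟩ := _root_.exists_rotate_eq_append hk hf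
    exact ⟨k, g, Or.inl h⟩
  · obtain ⟨k, g, h⟩ := _root_.exists_rotate_eq_append hk (List.reverse_infix.2 hf)
    exact ⟨k, g, Or.inr h⟩

theorem CycContains.reverse {c f : List ℕ} (h : CycContains c f) : CycContains c f.reverse := by
  obtain ⟨d, hcd, hf⟩ := h
  exact ⟨d.reverse, hcd.trans (dihEquiv_reverse d), List.reverse_infix.2 hf⟩

theorem CycContains.of_dihEquiv {c d f : List ℕ} (h : DihEquiv c d) (hd : CycContains d f) :
    CycContains c f := by
  obtain ⟨e, hde, hf⟩ := hd
  exact ⟨e, h.trans hde, hf⟩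

theorem exists_dihEquiv_cons_cons_cons {x : ℕ} {c : List ℕ} (hx : x ∈ c) (hc : 3 ≤ c.length) :
    ∃ a b t, DihEquiv c (a :: x :: b :: t) := by
  obtain ⟨u, v, rfl⟩ := List.append_of_mem hx
  have h := dihEquiv_append_comm u (x :: v)
  obtain ⟨b, w, hw⟩ : ∃ b w, v ++ u = b :: w :=
    List.exists_cons_of_length_pos (by simp at hc ⊢; omega)
  have hw' : w ≠ [] := by
    rintro rfl
    have := congrArg List.length hw
    simp at this hc
    omega
  obtain ⟨t, a, rfl⟩ := (List.eq_nil_or_concat' w).resolve_left hw'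
  rw [List.cons_append, hw] at h
  exact ⟨a, b, t, h.trans (dihEquiv_append_comm (x :: b :: t) [a])⟩

theorem cyc_eq_iff {c d : List ℕ} : cyc c = cyc d ↔ DihEquiv c d :=
  ⟨fun h => Quotient.exact h, fun h => Quotient.sound h⟩

theorem exists_cyc_eq (x : Cyc) : ∃ c, cyc c = x := Quotient.exists_rep x

/-! ### Quiddity cycles and continuant matrices -/

/-- The matrix `η(a)`. -/
def eta (a : ℤ) : Matrix (Fin 2) (Fin 2) ℤ := !![a, -1; 1, 0]

/-- The product `η(c₁) ⋯ η(cₙ)`. -/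
def etaProd (c : List ℕ) : Matrix (Fin 2) (Fin 2) ℤ := (c.map fun a => eta a).prod

/-- The product `η(c₁) ⋯ η(cₙ)` is plus or minus the identity. -/
def IsEtaCycle (c : List ℕ) : Prop := etaProd c = 1 ∨ etaProd c = -1

@[simp] theorem etaProd_nil : etaProd [] = 1 := rfl

@[simp] theorem etaProd_cons (a : ℕ) (c : List ℕ) : etaProd (a :: c) = eta a * etaProd c := by
  simp [etaProd]

@[simp] theorem etaProd_append (c d : List ℕ) :
    etaProd (c ++ d) = etaProd c * etaProd d := by
  simp [etaProd]

theorem eta_add_one_mul_one_mul (a b : ℤ) :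
    eta (a + 1) * (eta 1 * eta (b + 1)) = eta a * eta b := by
  ext i j
  fin_cases i <;> fin_cases j <;> (simp [eta, Matrix.mul_apply, Fin.sum_univ_two]; try ring)

theorem eta_mul_zero_mul (a b : ℤ) : eta a * (eta 0 * eta b) = -eta (a + b) := by
  ext i j
  fin_cases i <;> fin_cases j <;> simp [eta, Matrix.mul_apply, Fin.sum_univ_two]
  ring

theorem etaProd_ear (a b : ℕ) (t : List ℕ) :
    etaProd ((a + 1) :: 1 :: (b + 1) :: t) = etaProd (a :: b :: t) := by
  have := eta_add_one_mul_one_mul a b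
  simp only [etaProd_cons, Nat.cast_add, Nat.cast_one, ← Matrix.mul_assoc] at this ⊢
  rw [this]

theorem etaProd_zero (a b : ℕ) (t : List ℕ) :
    etaProd (a :: 0 :: b :: t) = -etaProd ((a + b) :: t) := by
  have := eta_mul_zero_mul a b
  simp only [etaProd_cons, Nat.cast_add, Nat.cast_zero, ← Matrix.mul_assoc] at this ⊢
  rw [this, neg_mul]

theorem isEtaCycle_ear {a b : ℕ} {t : List ℕ} :
    IsEtaCycle ((a + 1) :: 1 :: (b + 1) :: t) ↔ IsEtaCycle (a :: b :: t) := by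
  rw [IsEtaCycle, IsEtaCycle, etaProd_ear]

theorem isEtaCycle_zero {a b : ℕ} {t : List ℕ} :
    IsEtaCycle (a :: 0 :: b :: t) ↔ IsEtaCycle ((a + b) :: t) := by
  rw [IsEtaCycle, IsEtaCycle, etaProd_zero, neg_inj, neg_eq_iff_eq_neg, or_comm]

theorem mul_comm_of_mul_eq_one_or {A B : Matrix (Fin 2) (Fin 2) ℤ}
    (h : A * B = 1 ∨ A * B = -1) : B * A = 1 ∨ B * A = -1 := by
  rcases h with h | h
  · exact Or.inl (mul_eq_one_comm.1 h)
  · right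
    rw [← neg_eq_iff_eq_neg, ← neg_mul] at h ⊢
    rw [neg_mul, ← mul_neg]
    exact mul_eq_one_comm.1 h

theorem signMatrix_mul_self :
    (!![1, 0; 0, -1] : Matrix (Fin 2) (Fin 2) ℤ) * !![1, 0; 0, -1] = 1 := by
  simp [Matrix.one_fin_two]

theorem eta_eq_conj_transpose (a : ℤ) :
    eta a = !![1, 0; 0, -1] * (eta a).transpose * !![1, 0; 0, -1] := by
  have h : (eta a).transpose = !![a, 1; -1, 0] := by
    ext i j
    fin_cases i <;> fin_cases j <;> rfl
  rw [h]
  simp [eta]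

theorem etaProd_reverse (c : List ℕ) :
    etaProd c.reverse = !![1, 0; 0, -1] * (etaProd c).transpose * !![1, 0; 0, -1] := by
  induction c with
  | nil => simp only [List.reverse_nil, etaProd_nil, Matrix.transpose_one, mul_one,
      signMatrix_mul_self]
  | cons a c ih =>
    rw [List.reverse_cons, etaProd_append, ih, etaProd_cons, etaProd_cons, etaProd_nil, mul_one]
    nth_rw 1 [eta_eq_conj_transpose]
    rw [Matrix.transpose_mul]
    calc _ = !![1, 0; 0, -1] * (etaProd c).transpose * (!![1, 0; 0, -1] * !![1, 0; 0, -1]) *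
          (eta a).transpose * !![1, 0; 0, -1] := by simp only [Matrix.mul_assoc]
      _ = _ := by rw [signMatrix_mul_self, mul_one]; simp only [Matrix.mul_assoc]

theorem IsEtaCycle.of_dihStep {c d : List ℕ} (h : dihStep c d) (hc : IsEtaCycle c) :
    IsEtaCycle d := by
  rcases h with rfl | rfl
  · rcases c with _ | ⟨a, t⟩
    · exact hc
    · rw [IsEtaCycle, etaProd_cons] at hc
      simpa [IsEtaCycle] using mul_comm_of_mul_eq_one_or hc
  · rw [IsEtaCycle, etaProd_reverse]
    rcases hc with h | h <;> rw [h]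
    · exact Or.inl (by rw [Matrix.transpose_one, mul_one, signMatrix_mul_self])
    · exact Or.inr (by
        rw [Matrix.transpose_neg, Matrix.transpose_one, mul_neg, mul_one, neg_mul,
          signMatrix_mul_self])

theorem IsEtaCycle.of_dihEquiv {c d : List ℕ} (h : DihEquiv c d) (hc : IsEtaCycle c) :
    IsEtaCycle d :=
  h.transport (fun _ _ => IsEtaCycle.of_dihStep) hc

theorem etaProd_pos_of_two_le (c : List ℕ) (h : ∀ x ∈ c, 2 ≤ x) :
    0 ≤ etaProd c 1 0 ∧ etaProd c 1 0 < etaProd c 0 0 := by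
  induction c with
  | nil => simp
  | cons a c ih =>
    obtain ⟨h0, h1⟩ := ih fun x hx => h x (List.mem_cons_of_mem _ hx)
    have ha : (2 : ℤ) ≤ a := by exact_mod_cast h a List.mem_cons_self
    simp only [etaProd_cons, eta, Matrix.mul_apply, Fin.sum_univ_two]
    simp
    constructor <;> nlinarith

theorem IsEtaCycle.exists_lt_two {c : List ℕ} (hc : IsEtaCycle c) (hne : c ≠ []) :
    ∃ x ∈ c, x < 2 := by
  by_contra! h
  obtain ⟨a, t, rfl⟩ := List.exists_cons_of_ne_nil hne
  obtain ⟨h0, h1⟩ := etaProd_pos_of_two_le t fun x hx => h x (List.mem_cons_of_mem _ hx)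
  have h2 : etaProd (a :: t) 1 0 = etaProd t 0 0 := by
    simp [eta, Matrix.mul_apply, Fin.sum_univ_two]
  rcases hc with hc | hc <;> rw [hc] at h2 <;> simp at h2 <;> omega

theorem IsQuiddity.of_dihEquiv {c d : List ℕ} (h : DihEquiv c d) (hc : IsQuiddity c) :
    IsQuiddity d :=
  h.transport (fun _ _ h' hc' => hc'.dih h') hc

theorem IsQuiddity.isEtaCycle {c : List ℕ} (h : IsQuiddity c) :
    IsEtaCycle c ∧ c.sum + 6 = 3 * c.length := by
  induction h with
  | base =>
    refine ⟨Or.inr ?_, rfl⟩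
    ext i j
    fin_cases i <;> fin_cases j <;> simp [eta]
  | dih _ h ih =>
    have hp := DihEquiv.perm (Relation.EqvGen.rel _ _ h)
    exact ⟨ih.1.of_dihStep h, by rw [← hp.sum_eq, ← hp.length_eq]; exact ih.2⟩
  | grow _ ih =>
    refine ⟨isEtaCycle_ear.2 ih.1, ?_⟩
    have := ih.2
    simp at this ⊢
    omega

/-- Entries of a sequence with continuant product `±1` sum to at most `3n - 6`, and equality
characterizes quiddity cycles; the inequality is strict in the presence of a zero, except for
`(0,0)`. -/
theorem IsEtaCycle.sum_le_and_isQuiddity (n : ℕ) :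
    ∀ c : List ℕ, c.length = n → c ≠ [] → IsEtaCycle c →
      c.sum + 6 ≤ 3 * c.length ∧ (c.sum + 6 = 3 * c.length → IsQuiddity c) ∧
        (0 ∈ c → 3 ≤ c.length → c.sum + 6 < 3 * c.length) := by
  induction n using Nat.strong_induction_on with
  | _ n ih =>
  intro c hn hne hc
  by_cases h3 : 3 ≤ c.length
  · by_cases h0 : 0 ∈ c
    · obtain ⟨a, b, t, h⟩ := exists_dihEquiv_cons_cons_cons h0 h3
      have hs := h.perm.sum_eq
      have hl := h.perm.length_eq
      have := ih (t.length + 1) (by simp at hl; omega) ((a + b) :: t) (by simp) (by simp)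
        (isEtaCycle_zero.1 (hc.of_dihEquiv h))
      simp at hs hl this
      omega
    · obtain ⟨x, hx, hx2⟩ := hc.exists_lt_two hne
      obtain rfl : x = 1 := by
        have : x ≠ 0 := fun hx0 => h0 (hx0 ▸ hx)
        omega
      obtain ⟨a, b, t, h⟩ := exists_dihEquiv_cons_cons_cons hx h3
      obtain ⟨a, rfl⟩ := Nat.exists_eq_succ_of_ne_zero (n := a)
        fun ha => h0 (h.perm.mem_iff.2 (by simp [ha]))
      obtain ⟨b, rfl⟩ := Nat.exists_eq_succ_of_ne_zero (n := b)
        fun hb => h0 (h.perm.mem_iff.2 (by simp [hb]))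
      have hs := h.perm.sum_eq
      have hl := h.perm.length_eq
      obtain ⟨i1, i2, -⟩ := ih (t.length + 2) (by simp at hl; omega) (a :: b :: t) (by simp)
        (by simp) (isEtaCycle_ear.1 (hc.of_dihEquiv h))
      simp at hs hl i1 i2
      refine ⟨by omega, fun he => ?_, fun h => absurd h h0⟩
      exact (IsQuiddity.grow (i2 (by omega))).of_dihEquiv h.symm
  · match c, hne, h3 with
    | [a], _, _ =>
      exfalso
      rcases hc with hc | hc <;> simpa [eta] using congrFun (congrFun hc 1) 0
    | [a, b], _, _ =>
      have hab : a = 0 ∧ b = 0 := by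
        rcases hc with hc | hc <;>
        · have h1 := congrFun (congrFun hc 1) 0
          have h2 := congrFun (congrFun hc 0) 1
          simp [eta] at h1 h2
          omega
      obtain ⟨rfl, rfl⟩ := hab
      exact ⟨by simp, fun _ => IsQuiddity.base, fun _ h => absurd h (by simp)⟩
    | _ :: _ :: _ :: _, _, h3 => exact absurd (by simp) h3

theorem isQuiddity_iff {c : List ℕ} :
    IsQuiddity c ↔ IsEtaCycle c ∧ c.sum + 6 = 3 * c.length := by
  refine ⟨IsQuiddity.isEtaCycle, fun ⟨h, hs⟩ => ?_⟩
  have hne : c ≠ [] := by rintro rfl; simp at hs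
  exact (h.sum_le_and_isQuiddity _ c rfl hne).2.1 hs

theorem IsQuiddity.two_le_length {c : List ℕ} (h : IsQuiddity c) : 2 ≤ c.length := by
  have := h.isEtaCycle.2
  omega

theorem IsQuiddity.zero_notMem {c : List ℕ} (h : IsQuiddity c) (h3 : 3 ≤ c.length) : 0 ∉ c := by
  intro h0
  obtain ⟨hc, hs⟩ := h.isEtaCycle
  have hne : c ≠ [] := by rintro rfl; simp at h3
  exact absurd hs ((hc.sum_le_and_isQuiddity _ c rfl hne).2.2 h0 h3).ne

/-- An ear can be removed from a quiddity cycle. -/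
theorem isQuiddity_ear {a b : ℕ} {t : List ℕ} :
    IsQuiddity ((a + 1) :: 1 :: (b + 1) :: t) ↔ IsQuiddity (a :: b :: t) := by
  rw [isQuiddity_iff, isQuiddity_iff, isEtaCycle_ear]
  simp
  intro _
  omega

theorem IsQuiddity.eq_of_length_eq_two {c : List ℕ} (h : IsQuiddity c) (h2 : c.length = 2) :
    c = [0, 0] := by
  have hs := h.isEtaCycle.2
  obtain ⟨a, b, rfl⟩ := List.length_eq_two.1 h2
  simp at hs ⊢
  omega

theorem IsQuiddity.eq_of_cons_one_one {t : List ℕ} (h : IsQuiddity (1 :: 1 :: t)) : t = [1] := by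
  rcases t with _ | ⟨b, t⟩
  · simpa using h.isEtaCycle.2
  rcases b with _ | b
  · exact absurd (by simp) (h.zero_notMem (by simp))
  have h' : IsQuiddity (0 :: b :: t) := isQuiddity_ear.1 h
  have hl : (0 :: b :: t).length = 2 := by
    by_contra hl
    exact absurd (by simp) (h'.zero_notMem (by have := h'.two_le_length; omega))
  simpa using h'.eq_of_length_eq_two hl

theorem exists_isQuiddity_length (n : ℕ) : ∃ c, IsQuiddity c ∧ c.length = n + 2 := by
  induction n with
  | zero => exact ⟨_, IsQuiddity.base, rfl⟩
  | succ n ih =>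
    obtain ⟨c, hc, hl⟩ := ih
    match c, hl with
    | a :: b :: t, hl => exact ⟨_, hc.grow, by simpa using hl⟩

/-! ### The map `ψ` -/

@[simp] theorem psiL_nil : psiL [] = [] := rfl

@[simp] theorem psiL_cons (a : ℕ) (t : List ℕ) : psiL (a :: t) = (a + 2) :: 1 :: psiL t := rfl

@[simp] theorem psiL_append (c d : List ℕ) : psiL (c ++ d) = psiL c ++ psiL d := by
  simp [psiL]

theorem psiL_sum_length (c : List ℕ) :
    (psiL c).sum = c.sum + 3 * c.length ∧ (psiL c).length = 2 * c.length := by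
  induction c with
  | nil => simp
  | cons a c ih => simp [ih]; omega

theorem etaProd_psiL (c : List ℕ) :
    etaProd (psiL c) = !![1, 1; 0, 1] * etaProd c * !![1, -1; 0, 1] := by
  induction c with
  | nil => simp [Matrix.one_fin_two]
  | cons a c ih =>
    have h : (eta ((a + 2 : ℕ) : ℤ) * eta ((1 : ℕ) : ℤ)) * !![1, 1; 0, 1] =
        !![1, 1; 0, 1] * eta a := by
      ext i j
      fin_cases i <;> fin_cases j <;> simp [eta, Matrix.mul_apply, Fin.sum_univ_two] <;> ring
    simp only [psiL_cons, etaProd_cons, ih]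
    simp only [← Matrix.mul_assoc]
    rw [h]

theorem isEtaCycle_psiL {c : List ℕ} : IsEtaCycle (psiL c) ↔ IsEtaCycle c := by
  have hT : (!![1, 1; 0, 1] : Matrix (Fin 2) (Fin 2) ℤ) * !![1, -1; 0, 1] = 1 := by
    simp [Matrix.one_fin_two]
  have hT' : (!![1, -1; 0, 1] : Matrix (Fin 2) (Fin 2) ℤ) * !![1, 1; 0, 1] = 1 := by
    simp [Matrix.one_fin_two]
  have hc : etaProd c = !![1, -1; 0, 1] * etaProd (psiL c) * !![1, 1; 0, 1] := by
    rw [etaProd_psiL]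
    calc _ = (!![1, -1; 0, 1] * !![1, 1; 0, 1]) * etaProd c *
          (!![1, -1; 0, 1] * !![1, 1; 0, 1]) := by rw [hT', one_mul, mul_one]
      _ = _ := by simp only [Matrix.mul_assoc]
  constructor
  · rintro (h | h) <;> rw [h] at hc <;> simp [hT'] at hc
    · exact Or.inl (by rw [hc, Matrix.one_fin_two])
    · exact Or.inr (by rw [hc, Matrix.one_fin_two]; simp)
  · rintro (h | h) <;> rw [IsEtaCycle, etaProd_psiL, h]
    · exact Or.inl (by rw [mul_one, hT])
    · exact Or.inr (by rw [mul_neg, mul_one, neg_mul, hT])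

theorem isQuiddity_psiL {c : List ℕ} : IsQuiddity (psiL c) ↔ IsQuiddity c := by
  rw [isQuiddity_iff, isQuiddity_iff, isEtaCycle_psiL, (psiL_sum_length c).1,
    (psiL_sum_length c).2]
  refine and_congr_right fun _ => ?_
  omega

theorem iotaL_psiL_reverse (c : List ℕ) :
    (iotaL (psiL c)).reverse = iotaL (psiL c.reverse) := by
  induction c with
  | nil => rfl
  | cons a c ih => simp_all [iotaL]

/-- The sequences alternating between entries `1` and entries `> 1`. -/
def IsAlternating (c : List ℕ) : Prop := ∃ d, c = psiL d ∨ c.reverse = psiL d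

theorem one_cons_psiL_append (a : ℕ) (d : List ℕ) :
    (1 :: psiL d ++ [a + 2]).reverse = psiL (a :: d.reverse) := by
  have := iotaL_psiL_reverse d
  simp_all [iotaL]

theorem IsAlternating.of_dihStep {c d : List ℕ} (h : dihStep c d) (hc : IsAlternating c) :
    IsAlternating d := by
  obtain ⟨e, he⟩ := hc
  rcases h with rfl | rfl
  · rcases he with rfl | he
    · rcases e with _ | ⟨a, e⟩
      · exact ⟨[], Or.inl rfl⟩
      · exact ⟨a :: e.reverse, Or.inr (one_cons_psiL_append a e)⟩
    · rcases List.eq_nil_or_concat' e with rfl | ⟨e, a, rfl⟩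
      · rw [psiL_nil, List.reverse_eq_nil_iff] at he
        exact ⟨[], Or.inl (by simp [he])⟩
      · rw [List.reverse_eq_iff] at he
        refine ⟨a :: e.reverse, Or.inl ?_⟩
        have := iotaL_psiL_reverse e
        simp_all [iotaL]
  · rcases he with rfl | he
    · exact ⟨e, Or.inr (List.reverse_reverse _)⟩
    · exact ⟨e, Or.inl he⟩

theorem not_isAlternating (a b : ℕ) (t : List ℕ) :
    ¬ IsAlternating ((a + 2) :: (b + 2) :: t) := by
  rintro ⟨d, h | h⟩
  · rcases d with _ | ⟨x, d⟩ <;> simp at h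
  · rw [List.reverse_eq_iff] at h
    rcases List.eq_nil_or_concat' d with rfl | ⟨d, x, rfl⟩ <;> simp at h

/-! ### Encoding sequences without adjacent ones

A list of pairs `(e, b)` encodes the sequence with entries `e + 2`, each of them followed by an
entry `1` if its mark `b` is `true`. -/

/-- The sequence encoded by a list of marked entries. -/
def unmark : List (ℕ × Bool) → List ℕ
  | [] => []
  | (e, true) :: L => (e + 2) :: 1 :: unmark L
  | (e, false) :: L => (e + 2) :: unmark L

/-- The last mark of a list of marked entries, with default value `p`. -/
def lastMark : Bool → List (ℕ × Bool) → Bool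
  | p, [] => p
  | _, (_, b) :: L => lastMark b L

/-- The sequence `d` such that inserting an ear at all missing marks leads to `ψ(d)`, where `p`
is the mark in front of the list. -/
def saturate : Bool → List (ℕ × Bool) → List ℕ
  | _, [] => []
  | p, (e, b) :: L => (e + (!p).toNat + (!b).toNat) :: saturate b L

theorem unmark_append (L L' : List (ℕ × Bool)) : unmark (L ++ L') = unmark L ++ unmark L' := by
  induction L with
  | nil => rfl
  | cons x L ih => obtain ⟨e, _ | _⟩ := x <;> simp [unmark, ih]

theorem saturate_append (p : Bool) (L L' : List (ℕ × Bool)) :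
    saturate p (L ++ L') = saturate p L ++ saturate (lastMark p L) L' := by
  induction L generalizing p with
  | nil => rfl
  | cons x L ih => simp [saturate, lastMark, ih]

theorem lastMark_append (p : Bool) (L L' : List (ℕ × Bool)) :
    lastMark p (L ++ L') = lastMark (lastMark p L) L' := by
  induction L generalizing p with
  | nil => rfl
  | cons x L ih => simp [lastMark, ih]

theorem length_saturate (p : Bool) (L : List (ℕ × Bool)) :
    (saturate p L).length = L.length := by
  induction L generalizing p with
  | nil => rfl
  | cons x L ih => simp [saturate, ih]

theorem saturate_take (p : Bool) (L : List (ℕ × Bool)) (n : ℕ) :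
    saturate p (L.take n) = (saturate p L).take n := by
  induction L generalizing p n with
  | nil => simp [saturate]
  | cons x L ih => cases n <;> simp [saturate, ih]

theorem saturate_false_cons (e : ℕ) (b : Bool) (L : List (ℕ × Bool)) :
    saturate false ((e, b) :: L) = saturate true ((e + 1, b) :: L) := by
  simp [saturate]

theorem dihEquiv_unmark_rotate (L : List (ℕ × Bool)) (k : ℕ) :
    DihEquiv (unmark L) (unmark (L.rotate k)) := by
  have h := dihEquiv_append_comm (unmark (L.take (k % L.length))) (unmark (L.drop (k % L.length)))
  rwa [← unmark_append, ← unmark_append, List.take_append_drop,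
    ← List.rotate_eq_drop_append_take_mod] at h

theorem exists_saturate_rotate (L : List (ℕ × Bool)) (p : Bool) (hp : lastMark p L = p) (k : ℕ) :
    ∃ q, saturate q (L.rotate k) = (saturate p L).rotate k ∧ lastMark q (L.rotate k) = q := by
  induction k with
  | zero => exact ⟨p, by simp, by simpa using hp⟩
  | succ k ih =>
    obtain ⟨q, h, hq⟩ := ih
    rw [← List.rotate_rotate, ← List.rotate_rotate, ← h]
    generalize L.rotate k = M at hq ⊢
    rcases M with _ | ⟨⟨e, b⟩, t⟩
    · exact ⟨q, rfl, rfl⟩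
    · have hb : lastMark b t = q := hq
      exact ⟨b, by simp [saturate_append, saturate, hb], by simp [lastMark_append, lastMark]⟩

theorem lastMark_eq_true {p : Bool} {L : List (ℕ × Bool)} (hne : L ≠ [])
    (h : lastMark p L = true) : ∃ v, v ≠ [] ∧ unmark L = v ++ [1] := by
  obtain ⟨L', ⟨e, b⟩, rfl⟩ := (List.eq_nil_or_concat' L).resolve_left hne
  simp only [lastMark_append, lastMark] at h
  subst h
  exact ⟨unmark L' ++ [e + 2], by simp, by simp [unmark_append, unmark]⟩

/-- A positive sequence without adjacent ones is encoded by a list of marked entries. -/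
theorem exists_unmark_eq (n : ℕ) : ∀ w : List ℕ, w.length ≤ n → (∀ x ∈ w, x ≠ 0) →
    (∀ u v, 1 :: w ++ [1] ≠ u ++ 1 :: 1 :: v) →
    ∃ L, L ≠ [] ∧ w ++ [1] = unmark L ∧ ∀ p, lastMark p L = true := by
  induction n with
  | zero =>
    intro w hw _ h
    obtain rfl := List.length_eq_zero_iff.1 (Nat.le_zero.1 hw)
    exact absurd rfl (h [] [])
  | succ n ih =>
    intro w hw h0 h
    rcases w with _ | ⟨x, w⟩
    · exact absurd rfl (h [] [])
    obtain ⟨e, rfl⟩ : ∃ e, x = e + 2 := by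
      have hx0 := h0 x List.mem_cons_self
      have hx1 : x ≠ 1 := by rintro rfl; exact h [] _ rfl
      exact ⟨x - 2, by omega⟩
    rcases w with _ | ⟨y, w⟩
    · exact ⟨[(e, true)], by simp, by simp [unmark], by simp [lastMark]⟩
    by_cases hy : y = 1
    · subst hy
      obtain ⟨L, -, hL, hl⟩ := ih w (by simp at hw; omega) (fun z hz => h0 z (by simp [hz]))
        fun u v huv => h (1 :: (e + 2) :: u) v (by simpa using huv)
      exact ⟨(e, true) :: L, by simp, by simp [unmark, hL], fun _ => hl _⟩
    · obtain ⟨L, -, hL, hl⟩ := ih (y :: w) (by simp at hw ⊢; omega)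
        (fun z hz => h0 z (List.mem_cons_of_mem _ hz)) fun u v huv => by
          rcases u with _ | ⟨z, u⟩
          · simp at huv
            exact hy huv.1
          · simp at huv
            exact h (1 :: (e + 2) :: u) v (by simpa using huv.2)
      exact ⟨(e, false) :: L, by simp, by simpa [unmark] using hL, fun _ => hl _⟩

/-- Every quiddity cycle other than `(0,0)` and `(1,1,1)` is encoded, up to dihedral equivalence,
by a list of marked entries whose last mark is `true`. -/
theorem IsQuiddity.exists_unmark {c : List ℕ} (hc : IsQuiddity c)
    (h00 : ¬ DihEquiv [0, 0] c) (h111 : ¬ DihEquiv [1, 1, 1] c) :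
    ∃ L, L ≠ [] ∧ DihEquiv c (unmark L) ∧ ∀ p, lastMark p L = true := by
  have h3 : 3 ≤ c.length := by
    by_contra h
    have h2 := hc.two_le_length
    have := hc.eq_of_length_eq_two (by omega)
    exact h00 (this ▸ Relation.EqvGen.refl _)
  have h0 := hc.zero_notMem h3
  have h11 : ∀ t, ¬ DihEquiv c (1 :: 1 :: t) := fun t h => by
    have := (hc.of_dihEquiv h).eq_of_cons_one_one
    exact h111 (this ▸ h).symm
  obtain ⟨x, hx, hx2⟩ := hc.isEtaCycle.1.exists_lt_two (by rintro rfl; simp at h3)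
  obtain rfl : x = 1 := by
    have : x ≠ 0 := fun hx0 => h0 (hx0 ▸ hx)
    omega
  obtain ⟨u, v, rfl⟩ := List.append_of_mem hx
  have h : DihEquiv (u ++ 1 :: v) (v ++ u ++ [1]) := by
    have h := dihEquiv_append_comm (u ++ [1]) v
    rwa [List.append_assoc, List.singleton_append, ← List.append_assoc] at h
  have hlen := h.perm.length_eq
  obtain ⟨L, hL, hw, hl⟩ := exists_unmark_eq _ (v ++ u) le_rfl
    (fun x hx hx0 => h0 (hx0 ▸ h.perm.mem_iff.2 (List.mem_append_left _ hx))) fun s t hst => by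
      rcases s with _ | ⟨y, s⟩
      · rcases hvu : v ++ u with _ | ⟨z, w⟩
        · rw [hvu] at hlen
          simp at hlen h3
          omega
        · rw [hvu] at hst h
          simp at hst
          rw [hst.1] at h
          exact h11 w (h.trans (dihEquiv_append_comm (1 :: w) [1]))
      · simp at hst
        rw [List.append_assoc, hst.2] at h
        exact h11 (t ++ s) (h.trans (dihEquiv_append_comm s (1 :: 1 :: t)))
  exact ⟨L, hL, hw ▸ h, hl⟩

/-! ### The map `ρ` -/

theorem reflTransGen_rhoStep_unmark (w : List ℕ) (e : ℕ) (b : Bool) (L : List (ℕ × Bool)) :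
    Relation.ReflTransGen rhoStep (w ++ unmark ((e, b) :: L))
      (w ++ psiL (saturate true ((e, b) :: L))) := by
  induction L generalizing w e b with
  | nil =>
    rcases b with _ | _
    · exact .single (rhoStep.last w e)
    · exact .refl
  | cons x L ih =>
    obtain ⟨e', b'⟩ := x
    rcases b with _ | _
    · have h := ih (w ++ [e + 3, 1]) (e' + 1) b'
      refine Relation.ReflTransGen.head
        (b := w ++ (e + 3) :: 1 :: unmark ((e' + 1, b') :: L)) ?_ ?_
      · cases b' <;> exact rhoStep.mid w _ e e'
      · simpa [saturate] using h
    · simpa [saturate, unmark] using ih (w ++ [e + 2, 1]) e' b'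

theorem reflTransGen_rhoStep_iotaL (p : Bool) {L : List (ℕ × Bool)} (hL : L ≠ []) :
    Relation.ReflTransGen rhoStep ((if p then [1] else []) ++ unmark L)
      (iotaL (psiL (saturate p L))) := by
  obtain ⟨⟨e, b⟩, L, rfl⟩ := List.exists_cons_of_ne_nil hL
  rcases p with _ | _
  · have h := reflTransGen_rhoStep_unmark [1] (e + 1) b L
    rw [← saturate_false_cons] at h
    refine Relation.ReflTransGen.head (b := 1 :: unmark ((e + 1, b) :: L)) ?_ h
    cases b <;> exact rhoStep.head e _
  · exact reflTransGen_rhoStep_unmark [1] e b L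

theorem not_rhoStep_iotaL_psiL (f d : List ℕ) : ¬ rhoStep (iotaL (psiL f)) d := by
  have key : ∀ (f u v : List ℕ) (a b : ℕ), psiL f ≠ u ++ (a + 2) :: (b + 2) :: v := by
    intro f
    induction f with
    | nil => simp
    | cons x f ih =>
      intro u v a b h
      rcases u with _ | ⟨y, _ | ⟨z, u⟩⟩
      · simp at h
      · simp at h
      · simp at h
        exact ih u v a b h.2.2
  intro h
  generalize hc : iotaL (psiL f) = c at h
  cases h with
  | mid u v a b =>
    rcases u with _ | ⟨x, u⟩
    · simp [iotaL] at hc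
    · simp [iotaL] at hc
      exact key f u v a b hc.2
  | head a t => simp [iotaL] at hc
  | last u a =>
    have := congrArg List.reverse hc
    rw [iotaL_psiL_reverse] at this
    simp [iotaL] at this

theorem rhoStep.reverse {c d : List ℕ} (h : rhoStep c d) : rhoStep c.reverse d.reverse := by
  cases h with
  | mid u v a b => simpa using rhoStep.mid v.reverse u.reverse b a
  | head a t => simpa using rhoStep.last t.reverse a
  | last u a => simpa using rhoStep.head a u.reverse

theorem RhoEval.reverse {c d : List ℕ} (h : RhoEval c d) : RhoEval c.reverse d.reverse := by
  refine ⟨h.1.lift List.reverse (fun _ _ => rhoStep.reverse), fun e he => h.2 e.reverse ?_⟩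
  simpa using he.reverse

/-- Subtract from each entry `> 1` the contributions of its neighbours `1` and drop all other
entries; `p` records whether the preceding entry is at most `1`. On encoded sequences this is
the map `saturate`. -/
def rhoInvariant : Bool → List ℕ → List ℕ
  | _, [] => []
  | p, x :: t =>
    if x ≤ 1 then rhoInvariant true t
    else (x - 2 + (!p).toNat + (!t.head?.any (· ≤ 1)).toNat) :: rhoInvariant false t

theorem rhoInvariant_append (p : Bool) (u c d : List ℕ)
    (h : ∀ q, rhoInvariant q c = rhoInvariant q d)
    (hh : c.head?.any (· ≤ 1) = d.head?.any (· ≤ 1)) :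
    rhoInvariant p (u ++ c) = rhoInvariant p (u ++ d) := by
  induction u generalizing p with
  | nil => exact h p
  | cons x u ih =>
    have hu : (u ++ c).head?.any (· ≤ 1) = (u ++ d).head?.any (· ≤ 1) := by
      cases u
      · exact hh
      · rfl
    rw [List.cons_append, List.cons_append, rhoInvariant, rhoInvariant, ih, ih, hu]

theorem rhoStep.rhoInvariant_eq {c d : List ℕ} (h : rhoStep c d) :
    rhoInvariant false c = rhoInvariant false d := by
  cases h with
  | mid u v a b =>
    refine rhoInvariant_append _ _ _ _ (fun q => ?_) (by simp)
    simp [rhoInvariant]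
    omega
  | head a t => simp [rhoInvariant]
  | last u a =>
    refine rhoInvariant_append _ _ _ _ (fun q => ?_) (by simp)
    simp [rhoInvariant]
    omega

theorem rhoInvariant_psiL (f : List ℕ) : rhoInvariant true (psiL f) = f := by
  induction f with
  | nil => rfl
  | cons a f ih => simp [rhoInvariant, ih]

theorem length_rhoInvariant_le (p : Bool) (c : List ℕ) :
    (rhoInvariant p c).length ≤ c.length := by
  induction c generalizing p with
  | nil => simp [rhoInvariant]
  | cons x c ih =>
    rw [rhoInvariant]
    split_ifs
    · exact (ih true).trans (by simp)
    · simpa using ih false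

theorem length_rhoInvariant_lt (p : Bool) (c : List ℕ) (h : 1 ∈ c) :
    (rhoInvariant p c).length < c.length := by
  induction c generalizing p with
  | nil => simp at h
  | cons x c ih =>
    rw [rhoInvariant]
    split_ifs with hx
    · exact Nat.lt_succ_of_le (length_rhoInvariant_le true c)
    · have : 1 ∈ c := (List.mem_cons.1 h).resolve_left (by omega)
      simpa using ih false this

theorem exists_le_one_of_one_mem_rhoInvariant (c : List ℕ) (h : 1 ∈ rhoInvariant false c) :
    ∃ x ∈ c, x ≤ 1 := by
  induction c with
  | nil => simp [rhoInvariant] at h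
  | cons x c ih =>
    by_contra! hc
    have hx : ¬ x ≤ 1 := by have := hc x List.mem_cons_self; omega
    rw [rhoInvariant, if_neg hx, List.mem_cons] at h
    rcases h with h | h
    · rcases c with _ | ⟨y, c⟩
      · simp at h
      · have hy := hc y (by simp)
        have hy' : ¬ y ≤ 1 := by omega
        simp [hy'] at h
    · obtain ⟨y, hy, hy1⟩ := ih h
      have := hc y (List.mem_cons_of_mem _ hy)
      omega

theorem rhoStep.measure {c d : List ℕ} (h : rhoStep c d) :
    c.length ≤ d.length ∧ c.sum ≤ d.sum ∧ (0 ∈ c → 0 ∈ d) := by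
  cases h <;> simp <;> omega

theorem reflTransGen_rhoStep_measure {c d : List ℕ} (h : Relation.ReflTransGen rhoStep c d) :
    c.length ≤ d.length ∧ c.sum ≤ d.sum ∧ (0 ∈ c → 0 ∈ d) ∧
      rhoInvariant false c = rhoInvariant false d := by
  induction h with
  | refl => exact ⟨le_rfl, le_rfl, id, rfl⟩
  | tail _ h ih =>
    obtain ⟨h1, h2, h3⟩ := h.measure
    exact ⟨ih.1.trans h1, ih.2.1.trans h2, h3 ∘ ih.2.2.1, ih.2.2.2.trans h.rhoInvariant_eq⟩

theorem zero_notMem_psiL (f : List ℕ) : 0 ∉ psiL f := by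
  induction f with
  | nil => simp
  | cons a f ih => simpa using ih

/-- If `f` contains a `1`, then so does every preimage of `ι(ψ(f))` under `ρ`, and it is longer
than `f`. -/
theorem RhoEval.one_mem {f g : List ℕ} (h : RhoEval g (iotaL (psiL f))) (hf : 1 ∈ f) :
    1 ∈ g ∧ f.length < g.length := by
  obtain ⟨-, -, h0, hinv⟩ := reflTransGen_rhoStep_measure h.1
  have hf' : rhoInvariant false g = f := by
    rw [hinv, iotaL, rhoInvariant, if_pos le_rfl, rhoInvariant_psiL]
  have hg0 : 0 ∉ g := fun hg => by simpa [iotaL, zero_notMem_psiL] using h0 hg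
  obtain ⟨x, hx, hx1⟩ := exists_le_one_of_one_mem_rhoInvariant g (hf'.symm ▸ hf)
  obtain rfl : x = 1 := by
    have : x ≠ 0 := fun hx0 => hg0 (hx0 ▸ hx)
    omega
  exact ⟨hx, by simpa [hf'] using length_rhoInvariant_lt false g hx⟩

/-! ### The map `δ` -/

theorem reflTransGen_deltaStep_unmark (w : List ℕ) (e : ℕ) (b : Bool) (L : List (ℕ × Bool))
    (hL : lastMark b L = true) :
    Relation.ReflTransGen deltaStep (cyc (w ++ unmark ((e, b) :: L)))
      (cyc (w ++ psiL (saturate true ((e, b) :: L)))) := by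
  induction L generalizing w e b with
  | nil =>
    obtain rfl : b = true := hL
    exact .refl
  | cons x L ih =>
    obtain ⟨e', b'⟩ := x
    rcases b with _ | _
    · have h := ih (w ++ [e + 3, 1]) (e' + 1) b' hL
      refine Relation.ReflTransGen.head
        (b := cyc (w ++ (e + 3) :: 1 :: unmark ((e' + 1, b') :: L))) ?_ ?_
      · cases b' <;> exact ⟨e, e', _, cyc_eq_iff.2 (dihEquiv_append_comm w _),
          cyc_eq_iff.2 (dihEquiv_append_comm w _)⟩
      · simpa [saturate] using h
    · simpa [saturate, unmark] using ih (w ++ [e + 2, 1]) e' b' hL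

theorem not_deltaStep_psiL (d : List ℕ) (x : Cyc) : ¬ deltaStep (cyc (psiL d)) x := by
  rintro ⟨a, b, t, h, -⟩
  exact not_isAlternating a b t ((cyc_eq_iff.1 h).transport
    (fun _ _ => IsAlternating.of_dihStep) ⟨d, Or.inl rfl⟩)

theorem deltaEval_unmark {L : List (ℕ × Bool)} (hne : L ≠ []) (hL : ∀ p, lastMark p L = true) :
    DeltaEval (cyc (unmark L)) (cyc (psiL (saturate true L))) := by
  obtain ⟨⟨e, b⟩, L, rfl⟩ := List.exists_cons_of_ne_nil hne
  exact ⟨reflTransGen_deltaStep_unmark [] e b L (hL b), not_deltaStep_psiL _⟩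

theorem cyc_mem_quiddityCyc {c : List ℕ} : cyc c ∈ QuiddityCyc ↔ IsQuiddity c := by
  constructor
  · rintro ⟨d, hd, h⟩
    exact hd.of_dihEquiv (cyc_eq_iff.1 h.symm)
  · exact fun h => ⟨c, h, rfl⟩

theorem deltaStep.mem_quiddityCyc_iff {x y : Cyc} (h : deltaStep x y) :
    x ∈ QuiddityCyc ↔ y ∈ QuiddityCyc := by
  obtain ⟨a, b, t, rfl, rfl⟩ := h
  rw [cyc_mem_quiddityCyc, cyc_mem_quiddityCyc]
  exact isQuiddity_ear.symm

theorem DeltaEval.mem_quiddityCyc_iff {x y : Cyc} (h : DeltaEval x y) :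
    x ∈ QuiddityCyc ↔ y ∈ QuiddityCyc := by
  have h' := h.1
  clear h
  induction h' with
  | refl => rfl
  | tail _ h ih => exact ih.trans h.mem_quiddityCyc_iff

/-! ### Finiteness -/

theorem finite_setOf_length_le_sum_le (N S : ℕ) :
    {c : List ℕ | c.length ≤ N ∧ c.sum ≤ S}.Finite := by
  refine ((List.finite_length_le (Fin (S + 1)) N).image (List.map Fin.val)).subset ?_
  rintro c ⟨hN, hS⟩
  have hc : ∀ x ∈ c, x < S + 1 := fun x hx =>
    Nat.lt_succ_of_le ((List.single_le_sum (by simp) x hx).trans hS)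
  refine ⟨c.attach.map fun x => ⟨x.1, hc x.1 x.2⟩, by simpa using hN, ?_⟩
  simp [List.map_map, Function.comp_def]

theorem finite_setOf_cyc_mem {E : Set Cyc} (hE : E.Finite) : {c | cyc c ∈ E}.Finite := by
  refine Set.Finite.preimage' hE fun x _ => ?_
  obtain ⟨c, rfl⟩ := exists_cyc_eq x
  refine (finite_setOf_length_le_sum_le c.length c.sum).subset fun d hd => ?_
  have h := (cyc_eq_iff.1 hd).perm
  exact ⟨h.length_eq.le, h.sum_eq.le⟩

theorem reflTransGen_deltaStep_measure {x y : Cyc} (h : Relation.ReflTransGen deltaStep x y) :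
    ∀ c d, cyc c = x → cyc d = y → c.length ≤ d.length ∧ c.sum ≤ d.sum := by
  induction h with
  | refl =>
    intro c d hc hd
    have h := (cyc_eq_iff.1 (hc.trans hd.symm)).perm
    exact ⟨h.length_eq.le, h.sum_eq.le⟩
  | tail _ h ih =>
    obtain ⟨a, b, t, rfl, rfl⟩ := h
    intro c d hc hd
    have h := (cyc_eq_iff.1 hd).perm
    have h' := ih c _ hc rfl
    rw [h.length_eq, h.sum_eq]
    simp at h' ⊢
    omega

theorem finite_setOf_deltaEval (c : List ℕ) : {x | DeltaEval x (cyc c)}.Finite := by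
  refine ((finite_setOf_length_le_sum_le c.length c.sum).image cyc).subset fun x hx => ?_
  obtain ⟨d, rfl⟩ := exists_cyc_eq x
  exact ⟨d, reflTransGen_deltaStep_measure hx.1 d c rfl rfl, rfl⟩

theorem finite_setOf_rhoEval (c : List ℕ) : {g | RhoEval g c}.Finite := by
  refine (finite_setOf_length_le_sum_le c.length c.sum).subset fun g hg => ?_
  obtain ⟨hl, hs, -⟩ := reflTransGen_rhoStep_measure hg.1
  exact ⟨hl, hs⟩

/-! ### The main step -/

/-- A block that starts a rotation of `saturate true L` lifts to a block of `unmark L`. -/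
theorem exists_rhoEval_of_rotate_eq_append {L : List (ℕ × Bool)}
    (hL : lastMark true L = true) {f g : List ℕ} {k : ℕ} (hf : f ≠ [])
    (hlen : f.length < (saturate true L).length) (h : (saturate true L).rotate k = f ++ g) :
    ∃ f', RhoEval f' (iotaL (psiL f)) ∧ CycContains (unmark L) f' ∧
      f'.length < (unmark L).length := by
  obtain ⟨q, hq, hlast⟩ := exists_saturate_rotate L true hL k
  rw [h] at hq
  have hrot := dihEquiv_unmark_rotate L k
  have hlenL : (L.rotate k).length = (saturate true L).length := by
    rw [List.length_rotate, length_saturate]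
  generalize L.rotate k = M at hq hlast hrot hlenL
  have hfM : saturate q (M.take f.length) = f := by rw [saturate_take, hq, List.take_left]
  have hM : M.take f.length ++ M.drop f.length = M := List.take_append_drop _ _
  have hW : M.drop f.length ≠ [] := by
    rw [Ne, List.drop_eq_nil_iff]
    omega
  generalize M.take f.length = Y at hfM hM
  generalize M.drop f.length = W at hM hW
  have hY : Y ≠ [] := by
    rintro rfl
    exact hf hfM.symm
  have hlastW : lastMark q W = q := by
    obtain ⟨⟨e, b⟩, W, rfl⟩ := List.exists_cons_of_ne_nil hW
    rw [← hM, lastMark_append] at hlast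
    exact hlast
  have hrho := reflTransGen_rhoStep_iotaL q hY
  rw [hfM] at hrho
  refine ⟨_, ⟨hrho, not_rhoStep_iotaL_psiL f⟩, ?_⟩
  rw [hrot.perm.length_eq]
  rw [← hM, unmark_append] at hrot ⊢
  rcases q with _ | _
  · have hpos : unmark W ≠ [] := by
      obtain ⟨⟨e, b⟩, W, rfl⟩ := List.exists_cons_of_ne_nil hW
      cases b <;> simp [unmark]
    refine ⟨⟨_, hrot, ⟨[], unmark W, rfl⟩⟩, ?_⟩
    simpa using List.length_pos_of_ne_nil hpos
  · obtain ⟨v, hv, hW'⟩ := lastMark_eq_true hW hlastW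
    rw [hW'] at hrot ⊢
    refine ⟨⟨[1] ++ (unmark Y ++ v), hrot.trans ?_, ⟨[], v, by simp⟩⟩, ?_⟩
    · simpa using dihEquiv_append_comm (unmark Y ++ v) [1]
    · have := List.length_pos_of_ne_nil hv
      simp
      omega

/-- Strict containment in `saturate true L` lifts to strict containment in `unmark L`. -/
theorem exists_rhoEval_of_cycContains {L : List (ℕ × Bool)}
    (hL : lastMark true L = true) {f : List ℕ} (hf : f ≠ [])
    (hlen : f.length < (saturate true L).length) (h : CycContains (saturate true L) f) :
    ∃ f', RhoEval f' (iotaL (psiL f)) ∧ CycContains (unmark L) f' ∧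
      f'.length < (unmark L).length := by
  obtain ⟨k, g, h | h⟩ := h.exists_rotate_eq_append
  · exact exists_rhoEval_of_rotate_eq_append hL hf hlen h
  · obtain ⟨f', h1, h2, h3⟩ :=
      exists_rhoEval_of_rotate_eq_append hL (by simpa using hf) (by simpa using hlen) h
    refine ⟨f'.reverse, ?_, h2.reverse, by simpa using h3⟩
    simpa [iotaL_psiL_reverse] using h1.reverse

/-- A finite set of classes does not contain all quiddity cycles. -/
theorem exists_isQuiddity_cyc_notMem {E : Set Cyc} (hE : E.Finite) :
    ∃ c, IsQuiddity c ∧ cyc c ∉ E := by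
  by_contra! h
  obtain ⟨N, hN⟩ := ((finite_setOf_cyc_mem hE).image List.length).bddAbove
  obtain ⟨c, hc, hl⟩ := exists_isQuiddity_length N
  have := hN ⟨c, h c hc, rfl⟩
  omega

/-- Theorem (main step): from finite sets `E ⊆ 𝒜`, `F ⊆ ⋃ₘ ℕ₀ᵐ` satisfying
(1) `(0,0), (1,1,1) ∈ E`, (2) every quiddity cycle lies in `E` or strictly
contains an element of `F`, (3) every element of `F` contains a `1`, the sets
`E' = E ∪ δ⁻¹(ψ̄(E))` and `F' = ρ⁻¹(ι(ψ(F)))` are finite, satisfy the same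
three properties, and the minimal length in `F` is smaller than in `F'`. -/
theorem main_step (E : Set Cyc) (F : Set (List ℕ))
    (hEfin : E.Finite) (hFfin : F.Finite)
    (hEA : E ⊆ QuiddityCyc) (hFne : ∀ f ∈ F, f ≠ [])
    (h1 : cyc [0, 0] ∈ E ∧ cyc [1, 1, 1] ∈ E)
    (h2 : ∀ c : List ℕ, IsQuiddity c →
      cyc c ∈ E ∨ ∃ f ∈ F, CycContains c f ∧ f.length < c.length)
    (h3 : ∀ f ∈ F, 1 ∈ f)
    (E' : Set Cyc)
    (hE' : E' = E ∪ {x | ∃ y, (∃ c : List ℕ, cyc c ∈ E ∧ y = cyc (psiL c)) ∧ DeltaEval x y})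
    (F' : Set (List ℕ))
    (hF' : F' = {g | ∃ f ∈ F, RhoEval g (iotaL (psiL f))}) :
    E'.Finite ∧ F'.Finite ∧
    E' ⊆ QuiddityCyc ∧ (∀ f ∈ F', f ≠ []) ∧
    (cyc [0, 0] ∈ E' ∧ cyc [1, 1, 1] ∈ E') ∧
    (∀ c : List ℕ, IsQuiddity c →
      cyc c ∈ E' ∨ ∃ f ∈ F', CycContains c f ∧ f.length < c.length) ∧
    (∀ f ∈ F', 1 ∈ f) ∧
    sInf (List.length '' F) < sInf (List.length '' F') := by
  subst hE' hF'
  have hFne' : F.Nonempty := by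
    obtain ⟨c, hc, hcE⟩ := exists_isQuiddity_cyc_notMem hEfin
    obtain ⟨f, hf, -⟩ := (h2 c hc).resolve_left hcE
    exact ⟨f, hf⟩
  have hmem : ∀ g ∈ {g | ∃ f ∈ F, RhoEval g (iotaL (psiL f))}, 1 ∈ g := by
    rintro g ⟨f, hf, hg⟩
    exact (hg.one_mem (h3 f hf)).1
  refine ⟨hEfin.union ?_, ?_, Set.union_subset hEA ?_,
    fun g hg => List.ne_nil_of_mem (hmem g hg), ⟨Or.inl h1.1, Or.inl h1.2⟩, ?_, hmem, ?_⟩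
  · refine ((finite_setOf_cyc_mem hEfin).biUnion
      fun c _ => finite_setOf_deltaEval (psiL c)).subset ?_
    rintro x ⟨_, ⟨c, hc, rfl⟩, hx⟩
    exact Set.mem_biUnion (x := c) hc hx
  · refine (hFfin.biUnion fun f _ => finite_setOf_rhoEval (iotaL (psiL f))).subset ?_
    rintro g ⟨f, hf, hg⟩
    exact Set.mem_biUnion (x := f) hf hg
  · rintro x ⟨_, ⟨c, hc, rfl⟩, hx⟩
    rw [hx.mem_quiddityCyc_iff, cyc_mem_quiddityCyc, isQuiddity_psiL, ← cyc_mem_quiddityCyc]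
    exact hEA hc
  · intro c hc
    by_cases hcE : cyc c ∈ E
    · exact Or.inl (Or.inl hcE)
    obtain ⟨L, hne, hcL, hlast⟩ := hc.exists_unmark
      (fun h => hcE (cyc_eq_iff.2 h ▸ h1.1)) (fun h => hcE (cyc_eq_iff.2 h ▸ h1.2))
    have hδ := deltaEval_unmark hne hlast
    have hd : IsQuiddity (saturate true L) := by
      rw [← isQuiddity_psiL, ← cyc_mem_quiddityCyc, ← hδ.mem_quiddityCyc_iff, cyc_mem_quiddityCyc]
      exact hc.of_dihEquiv hcL
    rcases h2 _ hd with hdE | ⟨f, hf, hfd, hlen⟩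
    · rw [← cyc_eq_iff.2 hcL] at hδ
      exact Or.inl (Or.inr ⟨_, ⟨_, hdE, rfl⟩, hδ⟩)
    · obtain ⟨f', hf', hcont, hlen'⟩ :=
        exists_rhoEval_of_cycContains (hlast true) (hFne f hf) hlen hfd
      exact Or.inr ⟨f', ⟨f, hf, hf'⟩, hcont.of_dihEquiv hcL, by rwa [hcL.perm.length_eq]⟩
  · obtain ⟨f₀, hf₀⟩ := hFne'
    have hne : {g | ∃ f ∈ F, RhoEval g (iotaL (psiL f))}.Nonempty :=
      ⟨_, f₀, hf₀, .refl, not_rhoStep_iotaL_psiL f₀⟩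
    obtain ⟨g, ⟨f, hf, hg⟩, hgl⟩ := Nat.sInf_mem (hne.image List.length)
    rw [← hgl]
    exact (Nat.sInf_le (Set.mem_image_of_mem _ hf)).trans_lt (hg.one_mem (h3 f hf)).2
end

section
/- Every quiddity cycle contains at least one of the sequences (0,0), (1,1), (1,2), (1,3). -/
/-- The elementary matrix attached to an entry of a quiddity cycle. -/
def quiddityMatrix (a : ℕ) : Matrix (Fin 2) (Fin 2) ℤ := !![(a : ℤ), -1; 1, 0]

/-- The product of the elementary matrices along a sequence. -/
def quiddityProd (l : List ℕ) : Matrix (Fin 2) (Fin 2) ℤ := (l.map quiddityMatrix).prod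

lemma quiddityProd_cons (a : ℕ) (l : List ℕ) :
    quiddityProd (a :: l) = quiddityMatrix a * quiddityProd l := by
  simp [quiddityProd]

lemma quiddityProd_append (l m : List ℕ) :
    quiddityProd (l ++ m) = quiddityProd l * quiddityProd m := by
  simp [quiddityProd]

lemma quiddityProd_singleton (a : ℕ) : quiddityProd [a] = quiddityMatrix a := by
  simp [quiddityProd]

lemma quiddityProd_reverse (l : List ℕ) :
    quiddityProd l.reverse = !![1, 0; 0, -1] * (quiddityProd l).transpose * !![1, 0; 0, -1] := by
  induction l with
  | nil => decide
  | cons a l ih =>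
    rw [List.reverse_cons, quiddityProd_append, ih, quiddityProd_singleton, quiddityProd_cons]
    have key : !![1, 0; 0, -1] * quiddityMatrix a =
        (quiddityMatrix a).transpose * !![1, 0; 0, -1] := by
      ext i j
      fin_cases i <;> fin_cases j <;>
        simp [quiddityMatrix, Matrix.mul_apply, Fin.sum_univ_two]
    rw [Matrix.transpose_mul, mul_assoc, key]
    simp only [mul_assoc]

lemma quiddityProd_rotate_one {l : List ℕ} (h : quiddityProd l = -1) :
    quiddityProd (l.rotate 1) = -1 := by
  cases l with
  | nil => simpa using h
  | cons a l =>
    rw [quiddityProd_cons, ← neg_eq_iff_eq_neg, ← neg_mul, mul_eq_one_comm] at h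
    rw [List.rotate_cons_succ, List.rotate_zero, quiddityProd_append, quiddityProd_singleton,
      ← neg_eq_iff_eq_neg, ← mul_neg, h]

lemma IsQuiddity.quiddityProd_eq {c : List ℕ} (hc : IsQuiddity c) : quiddityProd c = -1 := by
  induction hc with
  | base => simp [quiddityProd, quiddityMatrix, Matrix.one_fin_two]
  | dih _ h ih =>
    rcases h with rfl | rfl
    · exact quiddityProd_rotate_one ih
    · rw [quiddityProd_reverse, ih]
      decide
  | @grow a b t _ ih =>
    have key : quiddityMatrix (a + 1) * (quiddityMatrix 1 * quiddityMatrix (b + 1)) =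
        quiddityMatrix a * quiddityMatrix b := by
      simp [quiddityMatrix]
      ring
    rw [← ih]
    simp only [quiddityProd_cons]
    rw [← mul_assoc (quiddityMatrix a), ← key]
    simp only [mul_assoc]

lemma IsQuiddity.eq_or_pos {c : List ℕ} (hc : IsQuiddity c) :
    c = [0, 0] ∨ ∀ a ∈ c, 0 < a := by
  induction hc with
  | base => simp
  | dih _ h ih =>
    rcases h with rfl | rfl <;> rcases ih with rfl | ih <;> simp_all
  | grow _ ih =>
    right
    rcases ih with h | ih <;> simp_all

/-- Along a sequence of positive entries in which every neighbour of a `1` is at least `4`,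
the first column of the matrix product stays in a positive cone. -/
lemma quiddityProd_cone (l : List ℕ) (hpos : ∀ a ∈ l, 0 < a)
    (hl : l.IsChain fun a b => (a = 1 → 4 ≤ b) ∧ (b = 1 → 4 ≤ a)) :
    0 < quiddityProd l 0 0 ∧ 0 ≤ quiddityProd l 1 0 ∧
      quiddityProd l 1 0 ≤ 2 * quiddityProd l 0 0 ∧
      ((∀ a ∈ l.head?, a ≠ 1) → quiddityProd l 1 0 ≤ quiddityProd l 0 0) ∧
      ((∀ a ∈ l.head?, 4 ≤ a) → 2 * quiddityProd l 1 0 ≤ quiddityProd l 0 0) := by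
  induction l with
  | nil => simp [quiddityProd]
  | cons c l ih =>
    rw [List.isChain_cons] at hl
    obtain ⟨hcl, hl⟩ := hl
    obtain ⟨hy, hx, h2, h1, h4⟩ := ih (fun a ha => hpos a (by simp [ha])) hl
    have hc : 0 < c := hpos c (by simp)
    have e0 : quiddityProd (c :: l) 0 0 = c * quiddityProd l 0 0 - quiddityProd l 1 0 := by
      simp [quiddityProd_cons, quiddityMatrix, Matrix.mul_apply, Fin.sum_univ_two, sub_eq_add_neg]
    have e1 : quiddityProd (c :: l) 1 0 = quiddityProd l 0 0 := by
      simp [quiddityProd_cons, quiddityMatrix, Matrix.mul_apply, Fin.sum_univ_two]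
    rw [e0, e1]
    generalize quiddityProd l 0 0 = y at *
    generalize quiddityProd l 1 0 = x at *
    simp only [List.head?_cons, Option.mem_some_iff, forall_eq']
    obtain rfl | h | h : c = 1 ∨ (2 ≤ c ∧ c < 4) ∨ 4 ≤ c := by omega
    · have := h4 fun a ha => (hcl a ha).1 rfl
      refine ⟨?_, ?_, ?_, ?_, ?_⟩ <;> omega
    · have := h1 fun a ha h' => absurd ((hcl a ha).2 h') (by omega)
      have : (2 : ℤ) * y ≤ c * y := by gcongr; exact_mod_cast h.1
      refine ⟨?_, ?_, ?_, ?_, ?_⟩ <;> omega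
    · have : (4 : ℤ) * y ≤ c * y := by gcongr; exact_mod_cast h
      refine ⟨?_, ?_, ?_, ?_, ?_⟩ <;> omega

/-- Every quiddity cycle contains at least one of `(0,0)`, `(1,1)`, `(1,2)`, `(1,3)`. -/
theorem quiddity_contains_short (c : List ℕ) (hc : IsQuiddity c) :
    CycContains c [0, 0] ∨ CycContains c [1, 1] ∨
    CycContains c [1, 2] ∨ CycContains c [1, 3] := by
  rcases hc.eq_or_pos with rfl | hpos
  · exact Or.inl ⟨_, .refl _, List.infix_rfl⟩
  by_contra hcon
  have avoid : ∀ c', DihEquiv c c' → ∀ b, 0 < b → [1, b] <:+: c' → 4 ≤ b := by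
    intro c' hc' b hb hinf
    by_contra hlt
    obtain rfl | rfl | rfl : b = 1 ∨ b = 2 ∨ b = 3 := by omega
    · exact hcon (.inr (.inl ⟨c', hc', hinf⟩))
    · exact hcon (.inr (.inr (.inl ⟨c', hc', hinf⟩)))
    · exact hcon (.inr (.inr (.inr ⟨c', hc', hinf⟩)))
  have hchain : c.IsChain fun a b => (a = 1 → 4 ≤ b) ∧ (b = 1 → 4 ≤ a) := by
    rw [List.isChain_iff_forall_rel_of_append_cons_cons]
    rintro a b l₁ l₂ h
    have hinf : [a, b] <:+: c := ⟨l₁, l₂, by simp [h]⟩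
    refine ⟨?_, ?_⟩
    · rintro rfl
      exact avoid c (.refl _) b (hpos b (by simp [h])) hinf
    · rintro rfl
      exact avoid c.reverse (.rel _ _ (.inr rfl)) a (hpos a (by simp [h]))
        (List.reverse_infix.2 hinf)
  have hcone := (quiddityProd_cone c hpos hchain).1
  rw [hc.quiddityProd_eq] at hcone
  simp at hcone
end

section
/- Let (q_1, q, q_2) ∈ (ℂˣ)³ be an affine triple, i.e., its characteristic sequence is defined (the triple is not broken) and is an affine sequence. Then, after possibly exchanging q_1 and q_2, the triple (q_1, q, q_2) equals one of the following, where μ_n denotes the set of primitive n-th roots of unity: (ζ, ζ, ζ) with ζ ∈ μ_3; (ζ², ζ⁵, ζ²) with ζ ∈ μ_6; (ζ, ζ⁴, ζ⁴) with ζ ∈ μ_6; (ζ⁴, ζ, ζ²), (ζ², ζ³, ζ²), or (ζ², ζ, ζ⁴) with ζ ∈ μ_6; (ζ, ζ¹⁰, ζ⁴) with ζ ∈ μ_12; (ζ, ζ⁴, ζ⁴) with ζ ∈ μ_5; (ζ⁴, ζ⁴, ζ) with ζ ∈ μ_8; (ζ, ζ⁹, ζ⁴) with ζ ∈ μ_10;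 (ζ, ζ¹⁰, ζ⁹) or (ζ⁹, ζ⁸, ζ⁴) with ζ ∈ μ_12; (ζ, ζ⁸, ζ⁶), (ζ⁶, ζ⁴, ζ³), (ζ³, ζ², ζ⁹), (ζ⁹, ζ⁴, ζ⁶), or (ζ⁶, ζ⁸, ζ⁷) with ζ ∈ μ_12; (ζ, ζ¹², ζ⁹) or (ζ⁹, ζ⁶, ζ⁴) with ζ ∈ μ_18; (t, t⁻², t) with t ∈ ℂˣ, t ∉ {±1}; (t, t⁻², −t) with t ∈ ℂˣ, t ∉ {±1}; (t, t⁻⁴, t⁴) with t ∈ ℂˣ, t ∉ {±1}, t ∉ μ_3, t ∉ μ_4. -/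
/-- A bi-infinite sequence is affine if it is obtained by concatenating
representatives of quiddity cycles `b k` (of lengths `≥ 2`), where block `k`
starts at position `s k`, interior entries are copied literally, and at each
junction the last entry of block `k-1` and the first entry of block `k` are
merged into the single entry `last + 2 + first`. -/
def IsAffineSeq (c : ℤ → ℕ) : Prop :=
  ∃ (b : ℤ → List ℕ) (s : ℤ → ℤ),
    (∀ k, IsQuiddity (b k)) ∧ (∀ k, 2 ≤ (b k).length) ∧
    (∀ k, s (k + 1) = s k + (b k).length - 1) ∧
    (∀ k, ∀ j : ℕ, 1 ≤ j → j + 1 < (b k).length → c (s k + j) = (b k).getD j 0) ∧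
    (∀ k, c (s k) = (b (k - 1)).getLastD 0 + 2 + (b k).headD 0)

/-- A bi-infinite sequence contains a finite sequence as a block of
consecutive entries. -/
def ZContains (c : ℤ → ℕ) (f : List ℕ) : Prop :=
  ∃ i : ℤ, ∀ j : ℕ, j < f.length → c (i + j) = f.getD j 0

/-- The defining set for `m₁` of a triple `(q₁, q, q₂)`. -/
def m1Set (t : ℂ × ℂ × ℂ) : Set ℕ :=
  {m | (∑ k ∈ Finset.range (m + 1), t.1 ^ k) = 0 ∨ t.1 ^ m * t.2.1 = 1}

/-- The defining set for `m₂` of a triple `(q₁, q, q₂)`. -/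
def m2Set (t : ℂ × ℂ × ℂ) : Set ℕ :=
  {m | (∑ k ∈ Finset.range (m + 1), t.2.2 ^ k) = 0 ∨ t.2.2 ^ m * t.2.1 = 1}

/-- `m₁(q)` is defined. -/
def M1Defined (t : ℂ × ℂ × ℂ) : Prop := (m1Set t).Nonempty

/-- `m₂(q)` is defined. -/
def M2Defined (t : ℂ × ℂ × ℂ) : Prop := (m2Set t).Nonempty

/-- `m₁(q)`, the minimum of the defining set (junk value `0` if undefined). -/
noncomputable def m1 (t : ℂ × ℂ × ℂ) : ℕ := sInf (m1Set t)

/-- `m₂(q)`, the minimum of the defining set (junk value `0` if undefined). -/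
noncomputable def m2 (t : ℂ × ℂ × ℂ) : ℕ := sInf (m2Set t)

/-- The reflection `σ₁(q₁, q, q₂) = (q₁, q₁^{-2m₁} q⁻¹, q₁^{m₁²} q^{m₁} q₂)`. -/
noncomputable def sigma1 (t : ℂ × ℂ × ℂ) : ℂ × ℂ × ℂ :=
  (t.1, (t.1 ^ (2 * m1 t))⁻¹ * t.2.1⁻¹, t.1 ^ (m1 t ^ 2) * t.2.1 ^ m1 t * t.2.2)

/-- The reflection `σ₂(q₁, q, q₂) = (q₁ q^{m₂} q₂^{m₂²}, q₂^{-2m₂} q⁻¹, q₂)`. -/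
noncomputable def sigma2 (t : ℂ × ℂ × ℂ) : ℂ × ℂ × ℂ :=
  (t.1 * t.2.1 ^ m2 t * t.2.2 ^ (m2 t ^ 2), (t.2.2 ^ (2 * m2 t))⁻¹ * t.2.1⁻¹, t.2.2)

/-- An unbroken bi-infinite sequence of triples `(qᵢ)` with `qᵢ₊₁ = σ₁(qᵢ)` for
even `i` and `qᵢ₊₁ = σ₂(qᵢ)` for odd `i`, all required `m`-values being defined. -/
def IsQChain (Q : ℤ → ℂ × ℂ × ℂ) : Prop :=
  ∀ i : ℤ, (Even i → M1Defined (Q i) ∧ Q (i + 1) = sigma1 (Q i)) ∧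
    (¬ Even i → M2Defined (Q i) ∧ Q (i + 1) = sigma2 (Q i))

/-- The characteristic sequence of an unbroken chain of triples:
`cᵢ` is the `m`-value of the map relating `qᵢ` and `qᵢ₊₁`. -/
noncomputable def charSeq (Q : ℤ → ℂ × ℂ × ℂ) (i : ℤ) : ℕ :=
  if i % 2 = 0 then m1 (Q i) else m2 (Q i)

/-- A triple is affine if it is not broken (its characteristic sequence is
defined) and its characteristic sequence is an affine sequence. -/
def AffineTriple (t : ℂ × ℂ × ℂ) : Prop :=
  ∃ Q : ℤ → ℂ × ℂ × ℂ, IsQChain Q ∧ Q 0 = t ∧ IsAffineSeq (charSeq Q)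

/-- The list of generalized Dynkin diagrams of affine bicharacters of rank two. -/
def IsAffineRow (t : ℂ × ℂ × ℂ) : Prop :=
  (∃ ζ : ℂ, IsPrimitiveRoot ζ 3 ∧ t = (ζ, ζ, ζ)) ∨
  (∃ ζ : ℂ, IsPrimitiveRoot ζ 6 ∧ t = (ζ ^ 2, ζ ^ 5, ζ ^ 2)) ∨
  (∃ ζ : ℂ, IsPrimitiveRoot ζ 6 ∧ t = (ζ, ζ ^ 4, ζ ^ 4)) ∨
  (∃ ζ : ℂ, IsPrimitiveRoot ζ 6 ∧
    (t = (ζ ^ 4, ζ, ζ ^ 2) ∨ t = (ζ ^ 2, ζ ^ 3, ζ ^ 2) ∨ t = (ζ ^ 2, ζ, ζ ^ 4))) ∨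
  (∃ ζ : ℂ, IsPrimitiveRoot ζ 12 ∧ t = (ζ, ζ ^ 10, ζ ^ 4)) ∨
  (∃ ζ : ℂ, IsPrimitiveRoot ζ 5 ∧ t = (ζ, ζ ^ 4, ζ ^ 4)) ∨
  (∃ ζ : ℂ, IsPrimitiveRoot ζ 8 ∧ t = (ζ ^ 4, ζ ^ 4, ζ)) ∨
  (∃ ζ : ℂ, IsPrimitiveRoot ζ 10 ∧ t = (ζ, ζ ^ 9, ζ ^ 4)) ∨
  (∃ ζ : ℂ, IsPrimitiveRoot ζ 12 ∧
    (t = (ζ, ζ ^ 10, ζ ^ 9) ∨ t = (ζ ^ 9, ζ ^ 8, ζ ^ 4))) ∨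
  (∃ ζ : ℂ, IsPrimitiveRoot ζ 12 ∧
    (t = (ζ, ζ ^ 8, ζ ^ 6) ∨ t = (ζ ^ 6, ζ ^ 4, ζ ^ 3) ∨ t = (ζ ^ 3, ζ ^ 2, ζ ^ 9) ∨
     t = (ζ ^ 9, ζ ^ 4, ζ ^ 6) ∨ t = (ζ ^ 6, ζ ^ 8, ζ ^ 7))) ∨
  (∃ ζ : ℂ, IsPrimitiveRoot ζ 18 ∧
    (t = (ζ, ζ ^ 12, ζ ^ 9) ∨ t = (ζ ^ 9, ζ ^ 6, ζ ^ 4))) ∨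
  (∃ s : ℂ, s ≠ 0 ∧ s ≠ 1 ∧ s ≠ -1 ∧ t = (s, (s ^ 2)⁻¹, s)) ∨
  (∃ s : ℂ, s ≠ 0 ∧ s ≠ 1 ∧ s ≠ -1 ∧ t = (s, (s ^ 2)⁻¹, -s)) ∨
  (∃ s : ℂ, s ≠ 0 ∧ s ≠ 1 ∧ s ≠ -1 ∧ ¬ IsPrimitiveRoot s 3 ∧ ¬ IsPrimitiveRoot s 4 ∧
    t = (s, (s ^ 4)⁻¹, s ^ 4))

/-- Binary trees, encoding the triangulations of a polygon with a distinguished base edge: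
`leaf` is the bare edge, and `node l r` is a triangle on the base edge with the triangulations
`l` and `r` glued to its two other sides. -/
inductive EarTree
  | leaf : EarTree
  | node (l r : EarTree) : EarTree

namespace EarTree

/-- The number of triangles at the left end of the base edge. -/
def left : EarTree → ℕ
  | leaf => 0
  | node l _ => left l + 1

/-- The number of triangles at the right end of the base edge. -/
def right : EarTree → ℕ
  | leaf => 0
  | node _ r => right r + 1

/-- The numbers of triangles at the vertices off the base edge, from left to right. -/
def inner : EarTree → List ℕ
  | leaf => []
  | node l r => inner l ++ (right l + 1 + left r) :: inner r

/-- The quiddity cycle of the triangulation, read from the left end of the base edge. -/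
def cycle (t : EarTree) : List ℕ := left t :: (inner t ++ [right t])

/-- The reflected triangulation. -/
def mirror : EarTree → EarTree
  | leaf => leaf
  | node l r => node (mirror r) (mirror l)

lemma left_mirror (t : EarTree) : left (mirror t) = right t := by
  induction t with
  | leaf => rfl
  | node l r _ hr => simp [mirror, left, right, hr]

lemma right_mirror (t : EarTree) : right (mirror t) = left t := by
  induction t with
  | leaf => rfl
  | node l r hl _ => simp [mirror, left, right, hl]

lemma inner_mirror (t : EarTree) : inner (mirror t) = (inner t).reverse := by
  induction t with
  | leaf => rfl
  | node l r hl hr =>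
    simp [mirror, inner, hl, hr, left_mirror, right_mirror]
    omega

lemma cycle_mirror (t : EarTree) : cycle (mirror t) = (cycle t).reverse := by
  simp [cycle, left_mirror, right_mirror, inner_mirror]

/-- Gluing two triangulations along their base edges and re-rooting the result at the edge to the
left of the first inner vertex of the first one. -/
lemma exists_cycle_glue (t s : EarTree) :
    ∃ u, cycle u = inner t ++ (right t + left s) :: (inner s ++ [right s + left t]) := by
  induction t generalizing s with
  | leaf => exact ⟨s, by simp [cycle, inner, left, right]⟩
  | node l r hl _ =>
    obtain ⟨u, hu⟩ := hl (node r s)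
    refine ⟨u, ?_⟩
    rw [hu]
    simp [inner, left, right]
    omega

lemma exists_cycle_rotate (t : EarTree) : ∃ u, cycle u = (cycle t).rotate 1 := by
  obtain ⟨u, hu⟩ := exists_cycle_glue t leaf
  exact ⟨u, hu.trans (by simp [cycle, inner, left, right])⟩

lemma exists_inner_grow (t : EarTree) {x : ℕ} {m : List ℕ} (h : inner t = x :: m) :
    ∃ u, left u = left t + 1 ∧ right u = right t ∧ inner u = 1 :: (x + 1) :: m := by
  induction t generalizing x m with
  | leaf => simp [inner] at h
  | node l r hl _ =>
    cases hi : inner l with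
    | nil =>
      cases l with
      | leaf =>
        simp only [inner, right, List.nil_append, List.cons.injEq] at h
        obtain ⟨rfl, rfl⟩ := h
        exact ⟨node (node leaf leaf) r, by simp [left], by simp [right],
          by simp [inner, left, right]; omega⟩
      | node l₁ l₂ => simp [inner] at hi
    | cons y ys =>
      obtain ⟨u, hu₁, hu₂, hu₃⟩ := hl hi
      simp only [inner, hi, List.cons_append, List.cons.injEq] at h
      obtain ⟨rfl, rfl⟩ := h
      exact ⟨node u r, by simp [left, hu₁], by simp [right], by simp [inner, hu₂, hu₃]⟩

lemma exists_cycle_grow (t : EarTree) {a b : ℕ} {m : List ℕ} (h : cycle t = a :: b :: m) :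
    ∃ u, cycle u = (a + 1) :: 1 :: (b + 1) :: m := by
  cases hi : inner t with
  | nil =>
    cases t with
    | leaf =>
      simp only [cycle, inner, left, right, List.nil_append, List.cons.injEq] at h
      obtain ⟨rfl, rfl, rfl⟩ := h
      exact ⟨node leaf leaf, rfl⟩
    | node l r => simp [inner] at hi
  | cons x xs =>
    obtain ⟨u, hu₁, hu₂, hu₃⟩ := t.exists_inner_grow hi
    simp only [cycle, hi, List.cons_append, List.cons.injEq] at h
    obtain ⟨rfl, rfl, rfl⟩ := h
    exact ⟨u, by simp [cycle, hu₁, hu₂, hu₃]⟩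

end EarTree

lemma IsQuiddity.exists_cycle {c : List ℕ} (h : IsQuiddity c) : ∃ t : EarTree, t.cycle = c := by
  induction h with
  | base => exact ⟨.leaf, rfl⟩
  | dih _ hd ih =>
    obtain ⟨t, rfl⟩ := ih
    rcases hd with rfl | rfl
    · exact t.exists_cycle_rotate
    · exact ⟨t.mirror, t.cycle_mirror⟩
  | grow _ ih =>
    obtain ⟨t, ht⟩ := ih
    exact t.exists_cycle_grow ht

/-- The sequence `c` reads `w` from position `i` on. -/
def ReadsAt (c : ℤ → ℕ) : ℤ → List ℕ → Prop
  | _, [] => True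
  | i, a :: w => c i = a ∧ ReadsAt c (i + 1) w

lemma readsAt_append {c : ℤ → ℕ} {i : ℤ} {u v : List ℕ} :
    ReadsAt c i (u ++ v) ↔ ReadsAt c i u ∧ ReadsAt c (i + u.length) v := by
  induction u generalizing i with
  | nil => simp [ReadsAt]
  | cons a u ih =>
    simp only [List.cons_append, ReadsAt, ih, List.length_cons, Nat.cast_add, Nat.cast_one,
      and_assoc]
    rw [show i + 1 + (u.length : ℤ) = i + (u.length + 1) by ring]

lemma readsAt_of_getD {c : ℤ → ℕ} {i : ℤ} {w : List ℕ}
    (h : ∀ j : ℕ, j < w.length → c (i + j) = w.getD j 0) : ReadsAt c i w := by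
  induction w generalizing i with
  | nil => trivial
  | cons a w ih =>
    refine ⟨by simpa using h 0 (by simp), ih fun j hj => ?_⟩
    have := h (j + 1) (by simpa using hj)
    simp only [List.getD_cons_succ] at this
    rw [← this]
    congr 1
    push_cast
    ring

lemma ReadsAt.of_infix {c : ℤ → ℕ} {i : ℤ} {u v : List ℕ} (h : ReadsAt c i v) (huv : u <:+: v) :
    ∃ j, ReadsAt c j u := by
  obtain ⟨x, y, rfl⟩ := huv
  rw [List.append_assoc, readsAt_append, readsAt_append] at h
  exact ⟨_, h.2.1⟩

/-- The sequence `c` is a concatenation of triangulated polygons `T k`, whose base edges join the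
vertices `s k` and `s (k + 1)`. -/
structure IsTreeSeq (c : ℤ → ℕ) (T : ℤ → EarTree) (s : ℤ → ℤ) : Prop where
  pos_succ : ∀ k, s (k + 1) = s k + 1 + (T k).inner.length
  reads : ∀ k, ReadsAt c (s k + 1) (T k).inner
  junction : ∀ k, c (s (k + 1)) = (T k).right + 2 + (T (k + 1)).left

lemma IsAffineSeq.exists_isTreeSeq {c : ℤ → ℕ} (h : IsAffineSeq c) :
    ∃ T s, IsTreeSeq c T s := by
  obtain ⟨b, s, hq, -, hs, hi, hj⟩ := h
  choose T hT using fun k => (hq k).exists_cycle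
  refine ⟨T, s, fun k => ?_, fun k => ?_, fun k => ?_⟩
  · rw [hs, ← hT]
    simp [EarTree.cycle]
    ring
  · refine readsAt_of_getD fun j hjl => ?_
    have := hi k (j + 1) (by omega) (by simpa [← hT, EarTree.cycle] using hjl)
    rw [← hT] at this
    push_cast at this
    rw [add_assoc, add_comm 1 (j : ℤ), this]
    rw [EarTree.cycle, List.getD_cons_succ, List.getD_append _ _ _ _ hjl]
  · have hlast : (T k).cycle.getLastD 0 = (T k).right := by
      rw [EarTree.cycle, ← List.cons_append, List.getLastD_concat]
    rw [hj, ← hT, ← hT, add_sub_cancel_right, hlast]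
    rfl

/-- The solution of `x (j + 1) = c j * x j - x (j - 1)` along the positions `i, i + 1, …`, started
with the values `a` at `i - 1` and `b` at `i`. -/
def walk (c : ℤ → ℕ) (i : ℤ) (a b : ℤ) : ℕ → ℤ
  | 0 => a
  | 1 => b
  | n + 2 => c (i + n) * walk c i a b (n + 1) - walk c i a b n

lemma walk_succ (c : ℤ → ℕ) (i : ℤ) (a b : ℤ) (n : ℕ) :
    walk c i a b (n + 1) = walk c (i + 1) b (c i * b - a) n := by
  induction n using Nat.twoStepInduction with
  | zero => rfl
  | one => simp [walk]
  | more n h₁ h₂ =>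
    rw [walk, h₁, h₂, walk]
    push_cast
    rw [show i + ((n : ℤ) + 1) = i + 1 + n by ring]

lemma EarTree.walk_pos {c : ℤ → ℕ} {i : ℤ} {x : ℕ → ℤ}
    (hx : ∀ n : ℕ, x (n + 2) = c (i + n) * x (n + 1) - x n) (t : EarTree) {m : ℕ} {a b : ℤ}
    (ha : 0 < a) (hb : 0 < b) (hr : ReadsAt c (i + m) t.inner) (hm : x m = a)
    (hm' : x (m + 1) = a * t.left + b) :
    (∀ j ≤ t.inner.length + 1, 0 < x (m + j)) ∧ x (m + t.inner.length + 1) = b ∧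
      x (m + t.inner.length) = b * t.right + a := by
  induction t generalizing m a b with
  | leaf =>
    simp only [inner, left, right, List.length_nil, add_zero, Nat.cast_zero, mul_zero,
      zero_add] at hm' ⊢
    refine ⟨fun j hj => ?_, hm', hm⟩
    interval_cases j
    · simpa [hm]
    · simpa [hm']
  | node l r hl hr' =>
    rw [inner, readsAt_append] at hr
    obtain ⟨hr₁, hr₂, hr₃⟩ := hr
    obtain ⟨p₁, e₁, f₁⟩ := hl ha (add_pos ha hb) hr₁ hm (by
      rw [hm', left]
      push_cast
      ring)
    have hrec := hx (m + l.inner.length)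
    rw [Nat.cast_add, ← add_assoc, hr₂, e₁, f₁] at hrec
    push_cast at hrec
    obtain ⟨p₂, e₂, f₂⟩ := hr' (m := m + l.inner.length + 1) (add_pos ha hb) hb
      (by convert hr₃ using 1; push_cast; ring) e₁ (by
        rw [show m + l.inner.length + 1 + 1 = m + l.inner.length + 2 by ring, hrec]
        ring)
    have hlen : (node l r).inner.length = l.inner.length + 1 + r.inner.length := by
      simp [inner]
      ring
    refine ⟨fun j hj => ?_, ?_, ?_⟩
    · rcases le_or_gt j (l.inner.length + 1) with h | h
      · exact p₁ j h
      · have := p₂ (j - (l.inner.length + 1)) (by omega)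
        rwa [show m + l.inner.length + 1 + (j - (l.inner.length + 1)) = m + j by omega] at this
    · rw [hlen, ← e₂]
      congr 1
      ring
    · rw [hlen, show m + (l.inner.length + 1 + r.inner.length)
        = m + l.inner.length + 1 + r.inner.length by ring, f₂, right]
      push_cast
      ring

namespace IsTreeSeq

variable {c : ℤ → ℕ} {T : ℤ → EarTree} {s : ℤ → ℤ}

lemma exists_pos_le (h : IsTreeSeq c T s) (i : ℤ) : ∃ k, s k ≤ i := by
  have key : ∀ n : ℕ, s (-n) ≤ s 0 - n := by
    intro n
    induction n with
    | zero => simp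
    | succ n ih =>
      have := h.pos_succ (-(n + 1 : ℕ))
      rw [show -((n + 1 : ℕ) : ℤ) + 1 = -n by push_cast; ring] at this
      push_cast at this ⊢
      omega
  refine ⟨-((s 0 - i).toNat : ℤ), (key _).trans ?_⟩
  omega

lemma exists_walk_eq_one (h : IsTreeSeq c T s) (k : ℤ) (n : ℕ) :
    ∃ m : ℕ, n ≤ m ∧ s (k + n) = s k + m ∧
      walk c (s k + 1) 1 (1 + (T k).left) m = 1 ∧
      walk c (s k + 1) 1 (1 + (T k).left) (m + 1) = 1 + (T (k + n)).left ∧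
      ∀ j ≤ m, 0 < walk c (s k + 1) 1 (1 + (T k).left) j := by
  set x := walk c (s k + 1) 1 (1 + (T k).left) with hx
  have hrec : ∀ n : ℕ, x (n + 2) = c (s k + 1 + n) * x (n + 1) - x n := fun n => by rw [hx, walk]
  induction n with
  | zero => exact ⟨0, le_rfl, by simp, by simp [hx, walk], by simp [hx, walk], by simp [hx, walk]⟩
  | succ n ih =>
    obtain ⟨m, hnm, hs, hm, hm', hpos⟩ := ih
    set t := T (k + n) with ht
    have hread : ReadsAt c (s k + 1 + m) t.inner := by
      rw [show s k + 1 + (m : ℤ) = s k + m + 1 by ring, ← hs]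
      exact h.reads _
    obtain ⟨hp, e, f⟩ := t.walk_pos hrec one_pos one_pos hread hm (by rw [hm']; ring)
    have hs' : s (k + (n + 1 : ℕ)) = s k + (m + t.inner.length + 1 : ℕ) := by
      rw [Nat.cast_add, Nat.cast_one, ← add_assoc, h.pos_succ, hs]
      push_cast
      ring
    refine ⟨m + t.inner.length + 1, by omega, hs', e, ?_, fun j hj => ?_⟩
    · have hj := h.junction (k + n)
      rw [show k + (n : ℤ) + 1 = k + (n + 1 : ℕ) by push_cast; ring, hs',
        show s k + ((m + t.inner.length + 1 : ℕ) : ℤ) = s k + 1 + (m + t.inner.length : ℕ) by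
          push_cast; ring] at hj
      have := hrec (m + t.inner.length)
      rw [hj, e, f] at this
      rw [show m + t.inner.length + 1 + 1 = m + t.inner.length + 2 by ring, this]
      push_cast
      ring
    · rcases le_or_gt j m with h' | h'
      · exact hpos j h'
      · have := hp (j - m) (by omega)
        rwa [show m + (j - m) = j by omega] at this

lemma walk_pos (h : IsTreeSeq c T s) (i : ℤ) (n : ℕ) : 0 < walk c i 0 1 (n + 1) := by
  obtain ⟨k, hk⟩ := h.exists_pos_le (i - 1)
  obtain ⟨d, hd⟩ := Int.le.dest hk
  set x := walk c (s k + 1) 1 (1 + (T k).left) with hx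
  have hrec : ∀ n : ℕ, x (n + 2) = c (s k + 1 + n) * x (n + 1) - x n := fun n => by rw [hx, walk]
  have hxpos : ∀ j, 0 < x j := fun j => by
    obtain ⟨m, hm, -, -, -, hp⟩ := h.exists_walk_eq_one k j
    exact hp j hm
  have hdet : ∀ n, walk c i 0 1 (n + 1) * x (d + n) - walk c i 0 1 n * x (d + n + 1) = x d := by
    intro n
    induction n with
    | zero => simp [walk]
    | succ n ih =>
      have hc : s k + 1 + ((d + n : ℕ) : ℤ) = i + n := by push_cast; omega
      have := hrec (d + n)
      rw [hc] at this
      rw [← add_assoc, show d + n + 1 + 1 = d + n + 2 by ring, this, walk, ← ih]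
      ring
  induction n with
  | zero => simp [walk]
  | succ n ih =>
    have h₁ := hdet (n + 1)
    have h₂ := mul_pos ih (hxpos (d + (n + 1) + 1))
    exact pos_of_mul_pos_left (by linarith [hxpos d]) (hxpos (d + (n + 1))).le

end IsTreeSeq

/-- Words `w` such that every concatenation of triangulated polygons contains one of them, with the
exponents `N` of the groups generated by the entries of the triples whose characteristic sequence
starts with `w`. The last component records whether there are exceptional triples for which
`p ^ m * r = 1` at every letter `m` of `w`. -/
def keyWordData : List (List ℕ × List ℕ × Bool) :=
  [([1, 2, 2], [12, 18], false), ([1, 2, 3], [24, 30], false), ([2, 1, 3], [12], false),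
    ([2, 1, 4], [18, 30], false), ([2, 1, 5], [6, 24], false), ([2, 2, 1], [12, 18], false),
    ([3, 1, 2], [12], false), ([3, 2, 1], [24, 30], false), ([4, 1, 2], [18, 30], false),
    ([5, 1, 2], [6, 24], false), ([1, 2, 4, 1], [14, 10, 6, 4], false),
    ([1, 3, 1, 5], [12, 14], false), ([1, 4, 1, 3], [12, 20], false),
    ([1, 4, 2, 1], [14, 10, 6, 4], false), ([2, 3, 1, 3], [24, 9], false),
    ([3, 1, 3, 2], [24, 9], false), ([3, 1, 4, 1], [12, 20], false),
    ([4, 1, 3, 1], [20, 6, 4], false), ([4, 2, 1, 6], [7, 6, 5, 4], false),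
    ([5, 1, 3, 1], [12, 14], false), ([6, 1, 2, 4], [7, 6, 5, 4], false),
    ([1, 6, 1, 3, 1], [18, 7, 4, 3], false), ([3, 3, 1, 3, 4], [8, 5, 4, 3], false),
    ([4, 3, 1, 3, 3], [8, 5, 4, 3], false), ([3, 3, 1, 3, 3, 1], [4, 10], false),
    ([3, 1, 4, 3], [20, 12, 10, 8], false), ([1, 3, 1, 3], [4, 6, 8], true),
    ([3, 1, 3, 1], [4, 6, 8], true), ([1, 4, 1, 4, 1], [8, 30], true),
    ([2, 2, 2, 2, 2, 2], [12], true)]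

/-- Words such that every concatenation of triangulated polygons contains one of them. -/
def keyWords : List (List ℕ) := keyWordData.map Prod.fst

/-- The word `w` contains one of `keyWords`. -/
def HasKeyWord (w : List ℕ) : Prop := ∃ u ∈ keyWords, u <:+: w

instance (w : List ℕ) : Decidable (HasKeyWord w) := by
  unfold HasKeyWord
  infer_instance

lemma HasKeyWord.of_infix {v w : List ℕ} (h : HasKeyWord v) (hvw : v <:+: w) : HasKeyWord w := by
  obtain ⟨u, hu, huv⟩ := h
  exact ⟨u, hu, huv.trans hvw⟩

namespace EarTree

/-- The nonempty binary trees of height at most two. -/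
def smallNodes : List EarTree :=
  [node leaf leaf, node (node leaf leaf) leaf, node leaf (node leaf leaf),
    node (node leaf leaf) (node leaf leaf)]

lemma mem_small_or_hasKeyWord (t : EarTree) :
    t ∈ leaf :: smallNodes ∨ HasKeyWord t.inner := by
  induction t with
  | leaf => simp
  | node l r hl hr =>
    rcases hl with hl | hl
    · rcases hr with hr | hr
      · fin_cases hl <;> fin_cases hr <;>
          first
          | refine Or.inr ?_; decide +kernel
          | simp [smallNodes]
      · exact Or.inr (hr.of_infix ⟨l.inner ++ [l.right + 1 + r.left], [], by simp [inner]⟩)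
    · exact Or.inr (hl.of_infix ⟨[], (l.right + 1 + r.left) :: r.inner, by simp [inner]⟩)

/-- The vertices off the base edges of the concatenation of two triangulated polygons `t` and `u`,
and of a concatenation whose first polygon is `u` and whose vertices are `w`. -/
def glue (t u : EarTree) (w : List ℕ) : List ℕ := t.inner ++ (t.right + 2 + u.left) :: w

lemma hasKeyWord_glue {t u v : EarTree} (ht : t ∈ leaf :: smallNodes) (hu : u ∈ smallNodes)
    (hv : v ∈ leaf :: smallNodes) (h : ¬ (t = leaf ∧ u = node leaf leaf ∧ v = leaf)) :
    HasKeyWord (glue t u (glue u v v.inner)) := by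
  fin_cases ht <;> fin_cases hu <;> fin_cases hv <;>
    first
    | exact (h ⟨rfl, rfl, rfl⟩).elim
    | decide +kernel

lemma hasKeyWord_glue_triangle {t u : EarTree} (ht : t ∈ leaf :: smallNodes)
    (hu : u ∈ leaf :: smallNodes) :
    HasKeyWord (glue t leaf (glue leaf (node leaf leaf)
      (glue (node leaf leaf) leaf (glue leaf u u.inner)))) := by
  fin_cases ht <;> fin_cases hu <;> decide +kernel

end EarTree

namespace IsTreeSeq

variable {c : ℤ → ℕ} {T : ℤ → EarTree} {s : ℤ → ℤ}

lemma readsAt_glue (h : IsTreeSeq c T s) {k : ℤ} {w : List ℕ}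
    (hw : ReadsAt c (s (k + 1) + 1) w) : ReadsAt c (s k + 1) ((T k).glue (T (k + 1)) w) := by
  rw [EarTree.glue, readsAt_append, ← h.pos_succ]
  exact ⟨h.reads k, h.junction k, hw⟩

lemma exists_keyWord (h : IsTreeSeq c T s) : ∃ w ∈ keyWords, ∃ i, ReadsAt c i w := by
  have key : ∀ {i w}, ReadsAt c i w → HasKeyWord w → ∃ w ∈ keyWords, ∃ i, ReadsAt c i w := by
    rintro i w hr ⟨u, hu, huw⟩
    exact ⟨u, hu, hr.of_infix huw⟩
  by_contra hno
  have hT : ∀ k, T k ∈ EarTree.leaf :: EarTree.smallNodes := fun k =>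
    (T k).mem_small_or_hasKeyWord.resolve_right fun h' => hno (key (h.reads k) h')
  by_cases hleaf : ∀ k, T k = .leaf
  · refine hno ⟨[2, 2, 2, 2, 2, 2], by decide, s 0, ?_⟩
    have hs : ∀ k, s (k + 1) = s k + 1 := fun k => by simp [h.pos_succ, hleaf, EarTree.inner]
    have hc : ∀ k, c (s k) = 2 := fun k => by
      have := h.junction (k - 1)
      rwa [sub_add_cancel, hleaf, hleaf] at this
    simp only [ReadsAt, ← hs, hc, and_self]
  · push Not at hleaf
    obtain ⟨k, hk⟩ := hleaf
    have hk' : T k ∈ EarTree.smallNodes := (List.mem_cons.mp (hT k)).resolve_left hk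
    have h₃ := h.readsAt_glue (h.readsAt_glue (h.reads (k - 1 + 1 + 1)))
    by_cases hex : T (k - 1) = .leaf ∧ T k = .node .leaf .leaf ∧ T (k + 1) = .leaf
    · have h₅ := h.readsAt_glue (h.readsAt_glue (h.readsAt_glue (h.readsAt_glue
        (h.reads (k - 2 + 1 + 1 + 1 + 1)))))
      rw [show k - 2 + 1 = k - 1 by ring, show k - 1 + 1 = k by ring, hex.1, hex.2.1, hex.2.2]
        at h₅
      exact hno (key h₅ (EarTree.hasKeyWord_glue_triangle (hT _) (hT _)))
    · rw [show k - 1 + 1 = k by ring] at h₃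
      exact hno (key h₃ (EarTree.hasKeyWord_glue (hT _) hk' (hT _) hex))

end IsTreeSeq

section Chain

variable {G : Type*} [CommGroup G]

/-- The condition on `m` in the definition of the `m`-value of a pair `(p, r)`. -/
def Hit (p r : G) (m : ℕ) : Prop := p ≠ 1 ∧ p ^ (m + 1) = 1 ∨ p ^ m * r = 1

/-- The `m`-value of the pair `(p, r)` is `m`. -/
def IsMValue (p r : G) (m : ℕ) : Prop := IsLeast {m | Hit p r m} m

/-- A bi-infinite sequence of reflected triples: the triple at position `i` consists of the
diagonal entry `p i` being reflected at, the off-diagonal entry `r i`, and the other diagonal entry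
`p (i - 1)`. -/
structure ReflChain (p r : ℤ → G) (c : ℤ → ℕ) : Prop where
  isMValue : ∀ i, IsMValue (p i) (r i) (c i)
  p_succ : ∀ i, p (i + 1) = p i ^ c i ^ 2 * r i ^ c i * p (i - 1)
  r_succ : ∀ i, r (i + 1) = (p i ^ (2 * c i))⁻¹ * (r i)⁻¹

lemma IsMValue.not_hit {p r : G} {m k : ℕ} (h : IsMValue p r m) (hk : k < m) : ¬ Hit p r k :=
  fun h' => (h.2 h').not_gt hk

lemma IsMValue.ne_one {p r : G} {m : ℕ} (h : IsMValue p r m) (hm : 0 < m) : p ≠ 1 := by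
  rintro rfl
  have := h.not_hit hm
  have h' := h.1
  simp_all [Hit]

lemma IsMValue.pow_ne_one {p r : G} {m k : ℕ} (h : IsMValue p r m) (hk : 0 < k) (hkm : k ≤ m) :
    p ^ k ≠ 1 := fun h' =>
  h.not_hit (k := k - 1) (by omega) (Or.inl ⟨h.ne_one (by omega), by
    rwa [Nat.sub_add_cancel hk]⟩)

lemma IsMValue.pow_mul_ne_one {p r : G} {m k : ℕ} (h : IsMValue p r m) (hkm : k < m) :
    p ^ k * r ≠ 1 := fun h' => h.not_hit hkm (Or.inr h')

lemma IsMValue.unique {p r : G} {m n : ℕ} (h : IsMValue p r m) (h' : IsMValue p r n) : m = n :=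
  IsLeast.unique h h'

/-- The `m`-value does not change under the reflection. -/
lemma IsMValue.reflect {p r : G} {m : ℕ} (h : IsMValue p r m) :
    IsMValue p ((p ^ (2 * m))⁻¹ * r⁻¹) m := by
  refine ⟨?_, fun k hk => ?_⟩
  · rcases h.1 with h' | h'
    · exact Or.inl h'
    · refine Or.inr ?_
      rw [eq_inv_of_mul_eq_one_right h', two_mul, pow_add]
      simp
  · by_contra! hkm
    rcases hk with hk | hk
    · exact h.pow_ne_one (Nat.succ_pos k) hkm hk.2
    · rcases h.1 with h' | h'
      · refine h.pow_mul_ne_one (k := m - 1 - k) (by omega) ?_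
        have e : 2 * m = k + (m - 1 - k) + (m + 1) := by omega
        rw [e, pow_add, h'.2, mul_one, pow_add, mul_inv, mul_assoc,
          mul_inv_cancel_left, ← mul_inv, inv_eq_one] at hk
        exact hk
      · refine h.pow_ne_one (k := m - k) (by omega) (by omega) ?_
        have e : 2 * m = k + (m - k) + m := by omega
        rw [eq_inv_of_mul_eq_one_right h', e, pow_add, pow_add] at hk
        rw [← inv_inj, inv_one, ← hk]
        simp

namespace ReflChain

variable {p r : ℤ → G} {c : ℤ → ℕ}

lemma reverse (h : ReflChain p r c) :
    ReflChain (fun i => p (-i)) (fun i => r (1 - i)) (fun i => c (-i)) where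
  isMValue i := by
    have := (h.isMValue (-i)).reflect
    rwa [← h.r_succ, neg_add_eq_sub] at this
  p_succ i := by
    have h₁ := h.p_succ (-i)
    have h₂ := h.r_succ (-i)
    rw [neg_add_eq_sub] at h₁ h₂
    rw [show -(i + 1) = -i - 1 by ring, show -(i - 1) = 1 - i by ring, h₁, h₂]
    simp only [mul_pow, inv_pow, ← pow_mul]
    rw [show 2 * c (-i) * c (-i) = c (-i) ^ 2 + c (-i) ^ 2 by ring, pow_add]
    simp [mul_assoc, mul_comm, mul_left_comm]
  r_succ i := by
    have h₂ := h.r_succ (-i)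
    rw [neg_add_eq_sub] at h₂
    rw [show 1 - (i + 1) = -i by ring, h₂]
    simp

lemma forward (h : ReflChain p r c) {P : G → G → G → Prop}
    (hP : ∀ {p r o m}, IsMValue p r m → P p r o →
      P (p ^ m ^ 2 * r ^ m * o) ((p ^ (2 * m))⁻¹ * r⁻¹) p)
    {i : ℤ} (hi : P (p i) (r i) (p (i - 1))) (n : ℕ) :
    P (p (i + n)) (r (i + n)) (p (i + n - 1)) := by
  induction n with
  | zero => simpa
  | succ n ih =>
    have := hP (h.isMValue _) ih
    rw [← h.p_succ, ← h.r_succ] at this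
    rwa [Nat.cast_add, Nat.cast_one, ← add_assoc, add_sub_cancel_right]

/-- A symmetric property of triples which is invariant under reflections holds everywhere along a
chain if it holds somewhere. -/
lemma transport (h : ReflChain p r c) {P : G → G → G → Prop}
    (hsymm : ∀ {p r o}, P p r o → P o r p)
    (hP : ∀ {p r o m}, IsMValue p r m → P p r o →
      P (p ^ m ^ 2 * r ^ m * o) ((p ^ (2 * m))⁻¹ * r⁻¹) p)
    {i : ℤ} (hi : P (p i) (r i) (p (i - 1))) (j : ℤ) : P (p j) (r j) (p (j - 1)) := by
  rcases le_total i j with hij | hij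
  · obtain ⟨n, rfl⟩ := Int.le.dest hij
    exact h.forward hP hi n
  · obtain ⟨n, rfl⟩ := Int.le.dest hij
    have := h.reverse.forward hP (i := 1 - (j + n)) (by
      have := hsymm hi
      simpa using this) n
    rw [show 1 - (j + (n : ℤ)) + n = 1 - j by ring] at this
    have := hsymm this
    simpa using this

end ReflChain

end Chain

/-- All entries of the triple are nonzero. -/
def Regular (t : ℂ × ℂ × ℂ) : Prop := t.1 ≠ 0 ∧ t.2.1 ≠ 0 ∧ t.2.2 ≠ 0

lemma regular_sigma1 {t : ℂ × ℂ × ℂ} : Regular (sigma1 t) ↔ Regular t := by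
  simp only [Regular, sigma1, ne_eq, mul_eq_zero, inv_eq_zero, pow_eq_zero_iff', not_or]
  tauto

lemma regular_sigma2 {t : ℂ × ℂ × ℂ} : Regular (sigma2 t) ↔ Regular t := by
  simp only [Regular, sigma2, ne_eq, mul_eq_zero, inv_eq_zero, pow_eq_zero_iff', not_or]
  tauto

lemma IsQChain.regular {Q : ℤ → ℂ × ℂ × ℂ} (h : IsQChain Q) (h₀ : Regular (Q 0)) (i : ℤ) :
    Regular (Q i) := by
  have key : ∀ i, Regular (Q (i + 1)) ↔ Regular (Q i) := fun i => by
    by_cases hi : Even i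
    · rw [((h i).1 hi).2, regular_sigma1]
    · rw [((h i).2 hi).2, regular_sigma2]
  induction i using Int.induction_on with
  | zero => exact h₀
  | succ i ih => exact (key _).2 ih
  | pred i ih => rwa [← key, sub_add_cancel]

lemma hit_units_iff {p r : ℂˣ} {m : ℕ} :
    Hit p r m ↔ ∑ k ∈ Finset.range (m + 1), (p : ℂ) ^ k = 0 ∨ (p : ℂ) ^ m * r = 1 := by
  have h : (p ≠ 1 ∧ p ^ (m + 1) = 1) ↔ ∑ k ∈ Finset.range (m + 1), (p : ℂ) ^ k = 0 := by
    have hg := geom_sum_mul (p : ℂ) (m + 1)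
    rw [← Units.val_inj (a := p ^ (m + 1)), ← Units.val_inj.ne]
    push_cast
    refine ⟨fun ⟨h₁, h₂⟩ => ?_, fun h => ⟨fun h₁ => ?_, ?_⟩⟩
    · rw [h₂, sub_self, mul_eq_zero] at hg
      exact hg.resolve_right (sub_ne_zero.2 h₁)
    · rw [h₁] at h
      simp only [one_pow, Finset.sum_const, Finset.card_range, nsmul_eq_mul, mul_one] at h
      exact Nat.cast_ne_zero.2 (Nat.succ_ne_zero m) h
    · rw [h, zero_mul] at hg
      exact (sub_eq_zero.1 hg.symm)
  rw [Hit, h, ← Units.val_inj (a := p ^ m * r)]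
  push_cast
  rfl

/-- The chain of triples of units underlying an unbroken chain of triples. -/
lemma IsQChain.exists_reflChain {Q : ℤ → ℂ × ℂ × ℂ} (h : IsQChain Q) (h₀ : Regular (Q 0)) :
    ∃ p r : ℤ → ℂˣ, ReflChain p r (charSeq Q) ∧ Q 0 = (↑(p 0), ↑(r 0), ↑(p (-1))) := by
  have hr := h.regular h₀
  let p : ℤ → ℂˣ := fun i =>
    if Even i then Units.mk0 (Q i).1 (hr i).1 else Units.mk0 (Q i).2.2 (hr i).2.2
  let r : ℤ → ℂˣ := fun i => Units.mk0 (Q i).2.1 (hr i).2.1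
  have hp₁ : ∀ {i}, Even i → (p i : ℂ) = (Q i).1 := fun hi => by simp [p, hi]
  have hp₂ : ∀ {i}, ¬ Even i → (p i : ℂ) = (Q i).2.2 := fun hi => by simp [p, hi]
  have ho₁ : ∀ {i}, Even i → (p (i - 1) : ℂ) = (Q i).2.2 := fun {i} hi => by
    have hi' : ¬ Even (i - 1) := by
      rw [Int.not_even_iff_odd]
      exact hi.sub_odd odd_one
    have := ((h (i - 1)).2 hi').2
    rw [sub_add_cancel] at this
    rw [hp₂ hi', this, sigma2]
  have ho₂ : ∀ {i}, ¬ Even i → (p (i - 1) : ℂ) = (Q i).1 := fun {i} hi => by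
    have hi' : Even (i - 1) := (Int.not_even_iff_odd.1 hi).sub_odd odd_one
    have := ((h (i - 1)).1 hi').2
    rw [sub_add_cancel] at this
    rw [hp₁ hi', this, sigma1]
  have hc₁ : ∀ {i}, Even i → charSeq Q i = m1 (Q i) := fun hi => if_pos (Int.even_iff.1 hi)
  have hc₂ : ∀ {i}, ¬ Even i → charSeq Q i = m2 (Q i) := fun hi =>
    if_neg fun h' => hi (Int.even_iff.2 h')
  refine ⟨p, r, ⟨fun i => ?_, fun i => ?_, fun i => ?_⟩, ?_⟩
  · by_cases hi : Even i
    · have hset : {m | Hit (p i) (r i) m} = m1Set (Q i) := by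
        ext m
        simp [hit_units_iff, hp₁ hi, m1Set, r]
      rw [IsMValue, hset, hc₁ hi]
      exact ⟨Nat.sInf_mem ((h i).1 hi).1, fun m hm => Nat.sInf_le hm⟩
    · have hset : {m | Hit (p i) (r i) m} = m2Set (Q i) := by
        ext m
        simp [hit_units_iff, hp₂ hi, m2Set, r]
      rw [IsMValue, hset, hc₂ hi]
      exact ⟨Nat.sInf_mem ((h i).2 hi).1, fun m hm => Nat.sInf_le hm⟩
  · rw [← Units.val_inj]
    by_cases hi : Even i
    · have hi' : ¬ Even (i + 1) := by simpa [Int.even_add_one]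
      push_cast
      rw [hp₂ hi', hp₁ hi, ho₁ hi, ((h i).1 hi).2, hc₁ hi]
      rfl
    · have hi' : Even (i + 1) := Int.even_add_one.2 hi
      push_cast
      rw [hp₁ hi', hp₂ hi, ho₂ hi, ((h i).2 hi).2, hc₂ hi]
      simp only [sigma2, r, Units.val_mk0]
      ring
  · rw [← Units.val_inj]
    by_cases hi : Even i
    · push_cast
      rw [hp₁ hi, hc₁ hi]
      simp only [r, Units.val_mk0]
      rw [((h i).1 hi).2, sigma1]
    · push_cast
      rw [hp₂ hi, hc₂ hi]
      simp only [r, Units.val_mk0]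
      rw [((h i).2 hi).2, sigma2]
  · have h' := ho₁ (i := 0) (by simp)
    rw [zero_sub] at h'
    rw [hp₁ (by simp), h']
    rfl

/-- The exponents of the sporadic triples of roots of unity in the list of affine rows: `(n, i, j, k)`
stands for `(ζ ^ i, ζ ^ j, ζ ^ k)` with `ζ` a primitive `n`-th root of unity. -/
def torsionRows : List (ℕ × ℕ × ℕ × ℕ) :=
  [(3, 1, 1, 1), (6, 2, 5, 2), (6, 1, 4, 4), (6, 4, 1, 2), (6, 2, 3, 2), (6, 2, 1, 4),
    (12, 1, 10, 4), (5, 1, 4, 4), (8, 4, 4, 1), (10, 1, 9, 4), (12, 1, 10, 9), (12, 9, 8, 4),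
    (12, 1, 8, 6), (12, 6, 4, 3), (12, 3, 2, 9), (12, 9, 4, 6), (12, 6, 8, 7), (18, 1, 12, 9),
    (18, 9, 6, 4)]

lemma isAffineRow_iff {t : ℂ × ℂ × ℂ} :
    IsAffineRow t ↔
      (∃ x ∈ torsionRows, ∃ ζ : ℂ, IsPrimitiveRoot ζ x.1 ∧
        t = (ζ ^ x.2.1, ζ ^ x.2.2.1, ζ ^ x.2.2.2)) ∨
      (∃ s : ℂ, s ≠ 0 ∧ s ≠ 1 ∧ s ≠ -1 ∧ t = (s, (s ^ 2)⁻¹, s)) ∨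
      (∃ s : ℂ, s ≠ 0 ∧ s ≠ 1 ∧ s ≠ -1 ∧ t = (s, (s ^ 2)⁻¹, -s)) ∨
      (∃ s : ℂ, s ≠ 0 ∧ s ≠ 1 ∧ s ≠ -1 ∧ ¬ IsPrimitiveRoot s 3 ∧ ¬ IsPrimitiveRoot s 4 ∧
        t = (s, (s ^ 4)⁻¹, s ^ 4)) := by
  simp only [IsAffineRow, torsionRows, List.mem_cons, List.not_mem_nil, or_false,
    exists_eq_or_imp, exists_eq_left, and_or_left, exists_or, or_assoc, pow_one]

lemma isAffineRow_units_iff {p r o : ℂˣ} :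
    IsAffineRow (↑p, ↑r, ↑o) ↔
      (∃ x ∈ torsionRows, ∃ ζ : ℂˣ, IsPrimitiveRoot ζ x.1 ∧
        p = ζ ^ x.2.1 ∧ r = ζ ^ x.2.2.1 ∧ o = ζ ^ x.2.2.2) ∨
      (p ^ 2 * r = 1 ∧ o ^ 2 = p ^ 2 ∧ p ^ 2 ≠ 1) ∨
      (p ^ 4 * r = 1 ∧ o = p ^ 4 ∧ p ^ 2 ≠ 1 ∧ p ^ 3 ≠ 1 ∧ p ^ 4 ≠ 1) := by
  have hval : ∀ n, ((p : ℂ) ^ n = 1 ↔ p ^ n = 1) := fun n => by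
    rw [← Units.val_inj (a := p ^ n)]
    simp
  have hinv : ∀ n, ((r : ℂ) = ((p : ℂ) ^ n)⁻¹ ↔ p ^ n * r = 1) := fun n => by
    rw [← Units.val_pow_eq_pow_val, ← Units.val_inv_eq_inv_val, Units.val_inj,
      eq_inv_iff_mul_eq_one, mul_comm]
  have hsq : p ^ 2 ≠ 1 ↔ (p : ℂ) ≠ 1 ∧ (p : ℂ) ≠ -1 := by
    rw [Ne, ← hval, ← not_or]
    nth_rw 1 [← one_pow (M := ℂ) 2]
    rw [sq_eq_sq_iff_eq_or_eq_neg]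
  have hsq' : o ^ 2 = p ^ 2 ↔ (o : ℂ) = p ∨ (o : ℂ) = -p := by
    rw [← sq_eq_sq_iff_eq_or_eq_neg, ← Units.val_inj (a := o ^ 2)]
    simp
  have hfour : (o : ℂ) = (p : ℂ) ^ 4 ↔ o = p ^ 4 := by
    rw [← Units.val_inj (b := p ^ 4)]
    simp
  have h₃ : p ^ 2 ≠ 1 → (p ^ 3 ≠ 1 ↔ ¬ IsPrimitiveRoot (p : ℂ) 3) := fun h => by
    rw [IsPrimitiveRoot.coe_units_iff, not_iff_not]
    refine ⟨fun h' => ?_, fun h' => h'.pow_eq_one⟩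
    have := orderOf_eq_prime h' fun h₁ => h (by rw [h₁, one_pow])
    simpa [this] using IsPrimitiveRoot.orderOf p
  have h₄ : p ^ 2 ≠ 1 → (p ^ 4 ≠ 1 ↔ ¬ IsPrimitiveRoot (p : ℂ) 4) := fun h => by
    rw [IsPrimitiveRoot.coe_units_iff, not_iff_not]
    refine ⟨fun h' => ?_, fun h' => h'.pow_eq_one⟩
    have := orderOf_eq_prime_pow (p := 2) (n := 1) h h'
    simpa [this] using IsPrimitiveRoot.orderOf p
  have hpos : ∀ x ∈ torsionRows, x.1 ≠ 0 := by decide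
  have htor : (∃ x ∈ torsionRows, ∃ ζ : ℂ, IsPrimitiveRoot ζ x.1 ∧
      ((p : ℂ), (r : ℂ), (o : ℂ)) = (ζ ^ x.2.1, ζ ^ x.2.2.1, ζ ^ x.2.2.2)) ↔
      ∃ x ∈ torsionRows, ∃ ζ : ℂˣ, IsPrimitiveRoot ζ x.1 ∧
        p = ζ ^ x.2.1 ∧ r = ζ ^ x.2.2.1 ∧ o = ζ ^ x.2.2.2 := by
    refine exists_congr fun x => and_congr_right fun hx => ⟨?_, ?_⟩
    · rintro ⟨ζ, hζ, h⟩
      obtain ⟨u, rfl⟩ := hζ.isUnit (hpos x hx)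
      simp only [Prod.mk.injEq] at h
      exact ⟨u, IsPrimitiveRoot.coe_units_iff.1 hζ, by exact_mod_cast h⟩
    · rintro ⟨ζ, hζ, rfl, rfl, rfl⟩
      exact ⟨ζ, IsPrimitiveRoot.coe_units_iff.2 hζ, by push_cast; rfl⟩
  rw [isAffineRow_iff, htor]
  refine or_congr_right ?_
  simp only [Prod.mk.injEq]
  constructor
  · rintro (⟨s, -, h₁, h₂, rfl, hr, ho⟩ | ⟨s, -, h₁, h₂, rfl, hr, ho⟩ |
      ⟨s, -, h₁, h₂, h₅, h₆, rfl, hr, ho⟩)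
    · exact Or.inl ⟨(hinv 2).1 hr, hsq'.2 (Or.inl ho), hsq.2 ⟨h₁, h₂⟩⟩
    · exact Or.inl ⟨(hinv 2).1 hr, hsq'.2 (Or.inr ho), hsq.2 ⟨h₁, h₂⟩⟩
    · have h := hsq.2 ⟨h₁, h₂⟩
      exact Or.inr ⟨(hinv 4).1 hr, hfour.1 ho, h, (h₃ h).2 h₅, (h₄ h).2 h₆⟩
  · rintro (⟨hr, ho, h⟩ | ⟨hr, ho, h, h₅, h₆⟩)
    · rcases hsq'.1 ho with ho | ho
      · exact Or.inl ⟨p, p.ne_zero, (hsq.1 h).1, (hsq.1 h).2, rfl, (hinv 2).2 hr, ho⟩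
      · exact Or.inr (Or.inl ⟨p, p.ne_zero, (hsq.1 h).1, (hsq.1 h).2, rfl, (hinv 2).2 hr, ho⟩)
    · exact Or.inr (Or.inr ⟨p, p.ne_zero, (hsq.1 h).1, (hsq.1 h).2, (h₃ h).1 h₅, (h₄ h).1 h₆, rfl,
        (hinv 4).2 hr, hfour.2 ho⟩)

/-- The triple occurs in the list of affine rows, up to exchanging the diagonal entries. -/
def IsRowlike (p r o : ℂˣ) : Prop := IsAffineRow (↑p, ↑r, ↑o) ∨ IsAffineRow (↑o, ↑r, ↑p)

lemma IsRowlike.symm {p r o : ℂˣ} (h : IsRowlike p r o) : IsRowlike o r p := Or.symm h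

lemma isRowlike_of_sq {p r o : ℂˣ} (h₁ : p ^ 2 * r = 1) (h₂ : o ^ 2 = p ^ 2) (h₃ : p ^ 2 ≠ 1) :
    IsRowlike p r o :=
  Or.inl (isAffineRow_units_iff.2 (Or.inr (Or.inl ⟨h₁, h₂, h₃⟩)))

lemma isRowlike_of_quartic {p r o : ℂˣ} (h₁ : p ^ 4 * r = 1) (h₂ : o = p ^ 4) (h₃ : p ^ 2 ≠ 1)
    (h₄ : p ^ 3 ≠ 1) (h₅ : p ^ 4 ≠ 1) : IsRowlike p r o :=
  Or.inl (isAffineRow_units_iff.2 (Or.inr (Or.inr ⟨h₁, h₂, h₃, h₄, h₅⟩)))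

/-! Triples of powers of a primitive `N`-th root of unity `ζ` are encoded by their exponents. -/

namespace Torsion

/-- The condition `Hit (ζ ^ a) (ζ ^ b) m` on exponents. -/
def hit (N a b m : ℕ) : Bool :=
  (!Nat.beq (a % N) 0 && Nat.beq ((m + 1) * a % N) 0) || Nat.beq ((m * a + b) % N) 0

/-- The `m`-value of `(ζ ^ a, ζ ^ b)` is `m`. -/
def isMValue (N a b m : ℕ) : Bool := hit N a b m && (List.range m).all fun k => !hit N a b k

/-- The `m`-value of `(ζ ^ a, ζ ^ b)`. -/
def mValue (N a b : ℕ) : Option ℕ := (List.range N).find? (hit N a b)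

/-- The exponent of the first entry after a reflection with `m`-value `m`. -/
def nextP (N a b o m : ℕ) : ℕ := (m * m * a + m * b + o) % N

/-- The exponent of the second entry after a reflection with `m`-value `m`. -/
def nextR (N a b m : ℕ) : ℕ := (N - 1) * (2 * m * a + b) % N

/-- The characteristic sequence starts with the given word. -/
def reads (N : ℕ) : ℕ → ℕ → ℕ → List ℕ → Bool
  | _, _, _, [] => true
  | a, b, o, m :: w =>
    isMValue N a b m && reads N (nextP N a b o m) (nextR N a b m) a w

/-- Within the given number of steps, some `m`-value is undefined or the walk along the
characteristic sequence becomes nonpositive. -/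
def dies (N : ℕ) : ℕ → ℕ → ℕ → ℕ → ℕ → ℕ → Bool
  | 0, _, _, _, _, _ => false
  | n + 1, a, b, o, x, y =>
    match mValue N a b with
    | none => true
    | some m =>
      Nat.ble (m * y) x || dies N n (nextP N a b o m) (nextR N a b m) a y (m * y - x)

/-- The triple is one of the sporadic rows. -/
def isTorsionRow (N a b o : ℕ) : Bool :=
  torsionRows.any fun x => N % x.1 == 0 && (List.range x.1).any fun g =>
    Nat.gcd g x.1 == 1 && N / x.1 * g * x.2.1 % N == a % N &&
      N / x.1 * g * x.2.2.1 % N == b % N && N / x.1 * g * x.2.2.2 % N == o % N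

/-- The triple belongs to one of the infinite families of rows. -/
def isFamilyRow (N a b o : ℕ) : Bool :=
  ((2 * a + b) % N == 0 && 2 * o % N == 2 * a % N && 2 * a % N != 0) ||
    ((4 * a + b) % N == 0 && o % N == 4 * a % N && 2 * a % N != 0 && 3 * a % N != 0 &&
      4 * a % N != 0)

/-- The triple occurs in the list of affine rows, up to exchanging the diagonal entries. -/
def isRow (N a b o : ℕ) : Bool :=
  isTorsionRow N a b o || isTorsionRow N o b a || isFamilyRow N a b o || isFamilyRow N o b a

/-- Every triple whose characteristic sequence starts with `w` either is broken, has a nonpositive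
walk, or occurs in the list of affine rows. -/
def checkWord (N : ℕ) (w : List ℕ) : Bool :=
  (List.range N).all fun a => (List.range N).all fun b => !isMValue N a b (w.headD 0) ||
    (List.range N).all fun o => !reads N a b o w || dies N 40 a b o 0 1 || isRow N a b o

/-- The reflection of the triple occurs again in the list of affine rows. -/
def checkStep (N a b o : ℕ) : Bool :=
  match mValue N a b with
  | none => true
  | some m => isRow N (nextP N a b o m) (nextR N a b m) a

lemma checkStep_torsionRows : ∀ x ∈ torsionRows, checkStep x.1 x.2.1 x.2.2.1 x.2.2.2 = true ∧
    checkStep x.1 x.2.2.2 x.2.2.1 x.2.1 = true := by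
  decide +kernel

variable {N a b o m : ℕ} {ζ : ℂˣ}

lemma pow_eq_one_iff (hζ : IsPrimitiveRoot ζ N) {k : ℕ} : ζ ^ k = 1 ↔ k % N = 0 := by
  rw [hζ.pow_eq_one_iff_dvd, Nat.dvd_iff_mod_eq_zero]

lemma pow_mod (hζ : IsPrimitiveRoot ζ N) (k : ℕ) : ζ ^ (k % N) = ζ ^ k := by
  rw [hζ.eq_orderOf, pow_mod_orderOf]

lemma pow_congr (hζ : IsPrimitiveRoot ζ N) {k l : ℕ} (h : k % N = l % N) : ζ ^ k = ζ ^ l := by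
  rw [← pow_mod hζ, h, pow_mod hζ]

lemma hit_iff (hζ : IsPrimitiveRoot ζ N) : hit N a b m = true ↔ Hit (ζ ^ a) (ζ ^ b) m := by
  simp only [hit, Hit, ← pow_mul', ← pow_add, ne_eq, pow_eq_one_iff hζ, Bool.or_eq_true,
    Bool.and_eq_true, Bool.not_eq_true', Bool.eq_false_iff, Nat.beq_eq]

lemma isMValue_iff (hζ : IsPrimitiveRoot ζ N) :
    isMValue N a b m = true ↔ IsMValue (ζ ^ a) (ζ ^ b) m := by
  simp only [isMValue, Bool.and_eq_true, List.all_eq_true, List.mem_range, Bool.not_eq_true',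
    Bool.eq_false_iff, ne_eq, hit_iff hζ]
  refine and_congr_right fun _ => ⟨fun h k hk => ?_, fun h k hk hk' => (h hk').not_gt hk⟩
  by_contra! hkm
  exact h k hkm hk

lemma mValue_eq_some_iff (hζ : IsPrimitiveRoot ζ N) (hN : 0 < N) :
    mValue N a b = some m ↔ IsMValue (ζ ^ a) (ζ ^ b) m := by
  rw [mValue, List.find?_range_eq_some, ← isMValue_iff hζ, isMValue, Bool.and_eq_true,
    List.all_eq_true]
  simp only [List.mem_range]
  refine and_congr_right fun h => and_iff_right_of_imp fun h' => ?_
  have hm : IsMValue (ζ ^ a) (ζ ^ b) m := by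
    rw [← isMValue_iff hζ, isMValue, Bool.and_eq_true, List.all_eq_true]
    simpa only [List.mem_range] using And.intro h h'
  by_contra! hm'
  refine hm.pow_ne_one hN hm' ?_
  rw [← pow_mul', pow_mul, hζ.pow_eq_one, one_pow]

lemma pow_nextP (hζ : IsPrimitiveRoot ζ N) :
    ζ ^ nextP N a b o m = (ζ ^ a) ^ m ^ 2 * (ζ ^ b) ^ m * ζ ^ o := by
  rw [nextP, pow_mod hζ]
  simp only [← pow_mul, ← pow_add]
  ring_nf

lemma pow_nextR (hζ : IsPrimitiveRoot ζ N) (hN : 0 < N) :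
    ζ ^ nextR N a b m = ((ζ ^ a) ^ (2 * m))⁻¹ * (ζ ^ b)⁻¹ := by
  rw [nextR, pow_mod hζ, ← mul_inv, ← mul_eq_one_iff_eq_inv]
  simp only [← pow_mul, ← pow_add]
  obtain ⟨n, rfl⟩ := Nat.exists_eq_add_of_lt hN
  rw [show (0 + n + 1 - 1) * (2 * m * a + b) + (a * (2 * m) + b)
    = (0 + n + 1) * (2 * m * a + b) by simp only [zero_add, Nat.add_sub_cancel]; ring, pow_mul,
    hζ.pow_eq_one, one_pow]

lemma isAffineRow_of_isTorsionRow (hζ : IsPrimitiveRoot ζ N) (hN : 0 < N)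
    (h : isTorsionRow N a b o = true) : IsAffineRow (↑(ζ ^ a), ↑(ζ ^ b), ↑(ζ ^ o)) := by
  simp only [isTorsionRow, List.any_eq_true, Bool.and_eq_true, beq_iff_eq] at h
  obtain ⟨x, hx, hn, g, -, ⟨⟨hg, ha⟩, hb⟩, ho⟩ := h
  refine isAffineRow_units_iff.2 (Or.inl ⟨x, hx, ζ ^ (N / x.1 * g), ?_, ?_, ?_, ?_⟩)
  · rw [pow_mul]
    exact (hζ.pow hN (Nat.div_mul_cancel (Nat.dvd_of_mod_eq_zero hn)).symm).pow_of_coprime g hg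
  all_goals
    rw [← pow_mul]
    exact pow_congr hζ (by simp only [ha, hb, ho])

lemma isRowlike_of_isFamilyRow (hζ : IsPrimitiveRoot ζ N) (h : isFamilyRow N a b o = true) :
    IsRowlike (ζ ^ a) (ζ ^ b) (ζ ^ o) := by
  simp only [isFamilyRow, Bool.or_eq_true, Bool.and_eq_true, beq_iff_eq, bne_iff_ne] at h
  rcases h with ⟨⟨h₁, h₂⟩, h₃⟩ | ⟨⟨⟨⟨h₁, h₂⟩, h₃⟩, h₄⟩, h₅⟩
  · refine isRowlike_of_sq ?_ ?_ ?_
    · rwa [← pow_mul', ← pow_add, pow_eq_one_iff hζ]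
    · rw [← pow_mul', ← pow_mul']
      exact pow_congr hζ h₂
    · rwa [← pow_mul', Ne, pow_eq_one_iff hζ]
  · refine isRowlike_of_quartic ?_ ?_ ?_ ?_ ?_
    · rwa [← pow_mul', ← pow_add, pow_eq_one_iff hζ]
    · rw [← pow_mul']
      exact pow_congr hζ h₂
    all_goals rwa [← pow_mul', Ne, pow_eq_one_iff hζ]

lemma isRowlike_of_isRow (hζ : IsPrimitiveRoot ζ N) (hN : 0 < N) (h : isRow N a b o = true) :
    IsRowlike (ζ ^ a) (ζ ^ b) (ζ ^ o) := by
  simp only [isRow, Bool.or_eq_true] at h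
  rcases h with ((h | h) | h) | h
  · exact Or.inl (isAffineRow_of_isTorsionRow hζ hN h)
  · exact Or.inr (isAffineRow_of_isTorsionRow hζ hN h)
  · exact isRowlike_of_isFamilyRow hζ h
  · exact (isRowlike_of_isFamilyRow hζ h).symm

lemma isRowlike_of_checkStep (hζ : IsPrimitiveRoot ζ N) (hN : 0 < N)
    (hm : IsMValue (ζ ^ a) (ζ ^ b) m) (h : checkStep N a b o = true) :
    IsRowlike ((ζ ^ a) ^ m ^ 2 * (ζ ^ b) ^ m * ζ ^ o) (((ζ ^ a) ^ (2 * m))⁻¹ * (ζ ^ b)⁻¹)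
      (ζ ^ a) := by
  rw [checkStep, (mValue_eq_some_iff hζ hN).2 hm] at h
  rw [← pow_nextP hζ, ← pow_nextR hζ hN]
  exact isRowlike_of_isRow hζ hN h

variable {p r : ℤ → ℂˣ} {c : ℤ → ℕ}

lemma reads_of_readsAt (hζ : IsPrimitiveRoot ζ N) (hN : 0 < N) (h : ReflChain p r c) {w : List ℕ}
    {i : ℤ} (hw : ReadsAt c i w) (hp : p i = ζ ^ a) (hr : r i = ζ ^ b) (ho : p (i - 1) = ζ ^ o) :
    reads N a b o w = true := by
  induction w generalizing i a b o with
  | nil => rfl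
  | cons m w ih =>
    obtain ⟨rfl, hw⟩ := hw
    have hm := h.isMValue i
    rw [hp, hr] at hm
    rw [reads, (isMValue_iff hζ).2 hm, Bool.true_and]
    refine ih hw ?_ ?_ ?_
    · rw [h.p_succ, hp, hr, ho, pow_nextP hζ]
    · rw [h.r_succ, hp, hr, pow_nextR hζ hN]
    · rw [add_sub_cancel_right, hp]

lemma dies_eq_false (hζ : IsPrimitiveRoot ζ N) (hN : 0 < N) (h : ReflChain p r c) {n x y : ℕ}
    {i : ℤ} (hpos : ∀ n, 0 < walk c i x y (n + 1)) (hp : p i = ζ ^ a) (hr : r i = ζ ^ b)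
    (ho : p (i - 1) = ζ ^ o) : dies N n a b o x y = false := by
  induction n generalizing i a b o x y with
  | zero => rfl
  | succ n ih =>
    have hm := h.isMValue i
    rw [hp, hr] at hm
    have hxy : x < c i * y := by
      have := hpos 1
      rw [walk, walk, walk, Nat.cast_zero, add_zero] at this
      exact_mod_cast sub_pos.1 this
    rw [dies, (mValue_eq_some_iff hζ hN).2 hm]
    simp only [Bool.or_eq_false_iff]
    refine ⟨Bool.eq_false_iff.2 fun h' => hxy.not_ge (Nat.le_of_ble_eq_true h'), ih (i := i + 1)
      (fun n => ?_) ?_ ?_ ?_⟩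
    · have := hpos (n + 1)
      rw [walk_succ] at this
      rwa [Nat.cast_sub hxy.le, Nat.cast_mul]
    · rw [h.p_succ, hp, hr, ho, pow_nextP hζ]
    · rw [h.r_succ, hp, hr, pow_nextR hζ hN]
    · rw [add_sub_cancel_right, hp]

lemma isRowlike_of_checkWord (h : ReflChain p r c) {i : ℤ}
    (hpos : ∀ n, 0 < walk c i 0 1 (n + 1)) {w : List ℕ} (hw₀ : w ≠ []) (hw : ReadsAt c i w)
    (hN : 0 < N) (hp : p i ^ N = 1) (hr : r i ^ N = 1) (ho : p (i - 1) ^ N = 1)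
    (hcheck : checkWord N w = true) : IsRowlike (p i) (r i) (p (i - 1)) := by
  have : NeZero N := ⟨hN.ne'⟩
  have hζ' := Complex.isPrimitiveRoot_exp N hN.ne'
  obtain ⟨ζ, hζe⟩ := hζ'.isUnit hN.ne'
  rw [← hζe, IsPrimitiveRoot.coe_units_iff] at hζ'
  have hex : ∀ u : ℂˣ, u ^ N = 1 → ∃ k < N, u = ζ ^ k := fun u hu => by
    obtain ⟨k, hk, hk'⟩ := hζ'.eq_pow_of_mem_rootsOfUnity ((mem_rootsOfUnity N u).2 hu)
    exact ⟨k, hk, hk'.symm⟩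
  obtain ⟨a, ha, hp⟩ := hex _ hp
  obtain ⟨b, hb, hr⟩ := hex _ hr
  obtain ⟨o, ho', ho⟩ := hex _ ho
  simp only [checkWord, List.all_eq_true, List.mem_range, Bool.or_eq_true] at hcheck
  have hreads := reads_of_readsAt hζ' hN h hw hp hr ho
  rw [hp, hr, ho]
  refine isRowlike_of_isRow hζ' hN ?_
  rcases hcheck a ha b hb with h' | h'
  · cases w with
    | nil => exact (hw₀ rfl).elim
    | cons m w =>
      rw [reads, Bool.and_eq_true] at hreads
      simp [hreads.1] at h'
  · have := h' o ho'
    rw [hreads, dies_eq_false hζ' hN h (x := 0) (y := 1) hpos hp hr ho] at this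
    simpa using this

end Torsion

lemma isMValue_of_pow_mul_eq_one {G : Type*} [CommGroup G] {p r : G} {m : ℕ} (h : p ^ m * r = 1)
    (hp : ∀ k, 0 < k → k ≤ m → p ^ k ≠ 1) : IsMValue p r m := by
  refine ⟨Or.inr h, fun k hk => ?_⟩
  by_contra! hkm
  rcases hk with hk | hk
  · exact hp _ k.succ_pos hkm hk.2
  · refine hp (m - k) (by omega) (by omega) ?_
    rw [eq_inv_of_mul_eq_one_right h, ← div_eq_mul_inv, div_eq_one] at hk
    have e : m = k + (m - k) := by omega
    rw [e, pow_add] at hk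
    exact left_eq_mul.1 hk

/-- If `p ^ m * r = 1` for the `m`-value `m`, the reflection exchanges the diagonal entries. -/
lemma IsRowlike.reflect_of_pow_mul_eq_one {p r o : ℂˣ} {m n : ℕ} (h : IsRowlike p r o)
    (hm : IsMValue p r m) (hn : p ^ n * r = 1) (hp : ∀ k, 0 < k → k ≤ n → p ^ k ≠ 1) :
    IsRowlike (p ^ m ^ 2 * r ^ m * o) ((p ^ (2 * m))⁻¹ * r⁻¹) p := by
  obtain rfl := hm.unique (isMValue_of_pow_mul_eq_one hn hp)
  have h₁ : p ^ m ^ 2 * r ^ m * o = o := by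
    rw [pow_two, pow_mul, ← mul_pow, hn, one_pow, one_mul]
  have h₂ : (p ^ (2 * m))⁻¹ * r⁻¹ = r := by
    rw [eq_inv_of_mul_eq_one_right hn, two_mul, pow_add]
    simp
  rw [h₁, h₂]
  exact h.symm

lemma IsRowlike.reflect {p r o : ℂˣ} {m : ℕ} (hm : IsMValue p r m) (h : IsRowlike p r o) :
    IsRowlike (p ^ m ^ 2 * r ^ m * o) ((p ^ (2 * m))⁻¹ * r⁻¹) p := by
  have hpos : ∀ x ∈ torsionRows, 0 < x.1 := by decide
  have hsq : ∀ {u : ℂˣ}, u ^ 2 ≠ 1 → u ≠ 1 := by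
    rintro u hu rfl
    simp at hu
  have h' := h
  rcases h' with h' | h' <;> rw [isAffineRow_units_iff] at h'
  · rcases h' with ⟨x, hx, ζ, hζ, rfl, rfl, rfl⟩ | ⟨h₁, h₂, h₃⟩ | ⟨h₁, h₂, h₃, h₄, h₅⟩
    · exact Torsion.isRowlike_of_checkStep hζ (hpos x hx) hm (Torsion.checkStep_torsionRows x hx).1
    · refine h.reflect_of_pow_mul_eq_one hm h₁ fun k hk hk' => ?_
      interval_cases k
      · simpa using hsq h₃
      · exact h₃
    · refine h.reflect_of_pow_mul_eq_one hm h₁ fun k hk hk' => ?_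
      interval_cases k
      · simpa using hsq h₃
      all_goals assumption
  · rcases h' with ⟨x, hx, ζ, hζ, rfl, rfl, rfl⟩ | ⟨h₁, h₂, h₃⟩ | ⟨h₁, h₂, h₃, h₄, h₅⟩
    · exact Torsion.isRowlike_of_checkStep hζ (hpos x hx) hm (Torsion.checkStep_torsionRows x hx).2
    · refine h.reflect_of_pow_mul_eq_one (n := 2) hm (by rwa [h₂]) fun k hk hk' => ?_
      rw [← h₂] at h₃
      interval_cases k
      · simpa using hsq h₃
      · exact h₃
    · refine h.reflect_of_pow_mul_eq_one (n := 1) hm (by rwa [pow_one, h₂]) fun k hk hk' => ?_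
      obtain rfl : k = 1 := by omega
      rwa [pow_one, h₂]

/-! Words `x ^ a * y ^ b * z ^ c` in three commuting letters are encoded by `(a, b, c)`, and
relations between `x`, `y` and `z` by a triangular basis of a lattice. -/

namespace MonomialRelation

/-- The linear combination `k • v + l • w`. -/
def comb (k : ℤ) (v : ℤ × ℤ × ℤ) (l : ℤ) (w : ℤ × ℤ × ℤ) : ℤ × ℤ × ℤ :=
  (k * v.1 + l * w.1, k * v.2.1 + l * w.2.1, k * v.2.2 + l * w.2.2)

/-- The Euclidean algorithm for a coordinate of two vectors, with a bound on the number of steps. -/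
def euclid (f : ℤ × ℤ × ℤ → ℤ) : ℕ → ℤ × ℤ × ℤ → ℤ × ℤ × ℤ → (ℤ × ℤ × ℤ) × ℤ × ℤ × ℤ
  | 0, b, v => (b, v)
  | n + 1, b, v => if f v = 0 then (b, v) else euclid f n v (comb 1 b (-(f b / f v)) v)

/-- Three vectors, which are in triangular form. -/
structure Basis where
  fst : ℤ × ℤ × ℤ
  snd : ℤ × ℤ × ℤ
  thd : ℤ × ℤ × ℤ

/-- Add a vector to the lattice with the given basis. -/
def Basis.insert (B : Basis) (v : ℤ × ℤ × ℤ) : Basis :=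
  let x := euclid (fun v => v.1) 20 B.fst v
  let y := euclid (fun v => v.2.1) 20 B.snd x.2
  let z := euclid (fun v => v.2.2) 20 B.thd y.2
  ⟨x.1, y.1, z.1⟩

/-- The vector reduces to zero modulo the basis. -/
def Basis.mem (B : Basis) (v : ℤ × ℤ × ℤ) : Bool :=
  let v := comb 1 v (-(v.1 / B.fst.1)) B.fst
  let v := comb 1 v (-(v.2.1 / B.snd.2.1)) B.snd
  let v := comb 1 v (-(v.2.2 / B.thd.2.2)) B.thd
  v == (0, 0, 0)

/-- Elements which are nontrivial if the `m`-value of `(P, R)` is `m`. -/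
def nontrivial (P R : ℤ × ℤ × ℤ) (m : ℕ) : List (ℤ × ℤ × ℤ) :=
  (List.range m).map (fun k : ℕ => comb (k + 1) P 0 R) ++
    (List.range m).map fun k : ℕ => comb k P 1 R

/-- Run through all choices between `p ^ m * r = 1` and `p ^ (m + 1) = 1` for the letters `m` of a
word, starting from a triple `(P, R, O)`. In each case the resulting relations have to contradict
the minimality of the `m`-values, or imply that the triple has one of the given exponents, or else
`p ^ m * r = 1` has been chosen everywhere, in the case `all = true`. -/
def check (Ns : List ℕ) : Bool → Basis → ℤ × ℤ × ℤ → ℤ × ℤ × ℤ → ℤ × ℤ × ℤ →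
    List (ℤ × ℤ × ℤ) → List ℕ → Bool
  | all, B, _, _, _, bad, [] => all || bad.any B.mem ||
      Ns.any fun N => B.mem (N, 0, 0) && B.mem (0, N, 0) && B.mem (0, 0, N)
  | all, B, P, R, O, bad, m :: w =>
    let P' := comb 1 (comb (m ^ 2) P m R) 1 O
    let R' := comb (-(2 * m)) P (-1) R
    let bad' := nontrivial P R m ++ bad
    check Ns all (B.insert (comb m P 1 R)) P' R' P bad' w &&
      check Ns false (B.insert (comb (m + 1) P 0 R)) P' R' P bad' w

/-- The check for the word `w`, starting from the generic triple. -/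
def checkWord (Ns : List ℕ) (all : Bool) (w : List ℕ) : Bool :=
  check Ns all ⟨(0, 0, 0), (0, 0, 0), (0, 0, 0)⟩ (1, 0, 0) (0, 1, 0) (0, 0, 1) [] w

variable {G : Type*} [CommGroup G] {x y z : G}

/-- The element encoded by a vector. -/
def eval (x y z : G) (v : ℤ × ℤ × ℤ) : G := x ^ v.1 * y ^ v.2.1 * z ^ v.2.2

lemma eval_comb (k l : ℤ) (v w : ℤ × ℤ × ℤ) :
    eval x y z (comb k v l w) = eval x y z v ^ k * eval x y z w ^ l := by
  simp only [eval, comb, zpow_add, mul_zpow, ← zpow_mul, mul_comm k, mul_comm l]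
  simp only [mul_assoc, mul_left_comm]

lemma eval_comb_eq_one {k l : ℤ} {v w : ℤ × ℤ × ℤ} (hv : eval x y z v = 1)
    (hw : eval x y z w = 1) : eval x y z (comb k v l w) = 1 := by
  simp [eval_comb, hv, hw]

lemma eval_euclid {f : ℤ × ℤ × ℤ → ℤ} {n : ℕ} {b v : ℤ × ℤ × ℤ} (hb : eval x y z b = 1)
    (hv : eval x y z v = 1) :
    eval x y z (euclid f n b v).1 = 1 ∧ eval x y z (euclid f n b v).2 = 1 := by
  induction n generalizing b v with
  | zero => exact ⟨hb, hv⟩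
  | succ n ih =>
    rw [euclid]
    split_ifs
    · exact ⟨hb, hv⟩
    · exact ih hv (eval_comb_eq_one hb hv)

/-- The vectors of the basis encode trivial elements. -/
structure Basis.Trivial (B : Basis) (x y z : G) : Prop where
  fst : eval x y z B.fst = 1
  snd : eval x y z B.snd = 1
  thd : eval x y z B.thd = 1

lemma Basis.Trivial.insert {B : Basis} (h : B.Trivial x y z) {v : ℤ × ℤ × ℤ}
    (hv : eval x y z v = 1) : (B.insert v).Trivial x y z := by
  have h₁ := eval_euclid (f := fun v => v.1) (n := 20) h.fst hv
  have h₂ := eval_euclid (f := fun v => v.2.1) (n := 20) h.snd h₁.2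
  have h₃ := eval_euclid (f := fun v => v.2.2) (n := 20) h.thd h₂.2
  exact ⟨h₁.1, h₂.1, h₃.1⟩

lemma Basis.Trivial.eval_eq_one {B : Basis} (h : B.Trivial x y z) {v : ℤ × ℤ × ℤ}
    (hv : B.mem v = true) : eval x y z v = 1 := by
  have key : ∀ {w b : ℤ × ℤ × ℤ} {k : ℤ}, eval x y z b = 1 →
      eval x y z (comb 1 w k b) = eval x y z w := fun hb => by simp [eval_comb, hb]
  rw [Basis.mem, beq_iff_eq] at hv
  rw [← key h.fst, ← key h.snd, ← key h.thd, hv]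
  simp [eval]

lemma eval_ne_one_of_mem_nontrivial {P R v : ℤ × ℤ × ℤ} {m : ℕ}
    (h : IsMValue (eval x y z P) (eval x y z R) m) (hv : v ∈ nontrivial P R m) :
    eval x y z v ≠ 1 := by
  simp only [nontrivial, List.mem_append, List.mem_map, List.mem_range] at hv
  rcases hv with ⟨k, hk, rfl⟩ | ⟨k, hk, rfl⟩
  · rw [eval_comb, zpow_zero, mul_one]
    exact_mod_cast h.pow_ne_one k.succ_pos hk
  · simpa [eval_comb] using h.pow_mul_ne_one hk

variable {p r : ℤ → G} {c : ℤ → ℕ}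

lemma of_check (h : ReflChain p r c) {Ns : List ℕ} {all : Bool} {B : Basis}
    {P R O : ℤ × ℤ × ℤ} {bad : List (ℤ × ℤ × ℤ)} {w : List ℕ} {i : ℤ} (hB : B.Trivial x y z)
    (hP : eval x y z P = p i) (hR : eval x y z R = r i) (hO : eval x y z O = p (i - 1))
    (hbad : ∀ v ∈ bad, eval x y z v ≠ 1) (hw : ReadsAt c i w)
    (hcheck : check Ns all B P R O bad w = true) :
    (∃ N ∈ Ns, x ^ N = 1 ∧ y ^ N = 1 ∧ z ^ N = 1) ∨
      (all = true ∧ ∀ j < w.length, p (i + j) ^ c (i + j) * r (i + j) = 1) := by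
  induction w generalizing i all B P R O bad with
  | nil =>
    simp only [check, Bool.or_eq_true, List.any_eq_true, Bool.and_eq_true] at hcheck
    rcases hcheck with (h' | ⟨v, hv, hv'⟩) | ⟨N, hN, ⟨h₁, h₂⟩, h₃⟩
    · exact Or.inr ⟨h', by simp⟩
    · exact (hbad v hv (hB.eval_eq_one hv')).elim
    · refine Or.inl ⟨N, hN, ?_, ?_, ?_⟩
      · simpa [eval] using hB.eval_eq_one h₁
      · simpa [eval] using hB.eval_eq_one h₂
      · simpa [eval] using hB.eval_eq_one h₃
  | cons m w ih =>
    obtain ⟨rfl, hw⟩ := hw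
    have hm := h.isMValue i
    have hP' : eval x y z (comb 1 (comb ((c i : ℤ) ^ 2) P (c i) R) 1 O) = p (i + 1) := by
      rw [h.p_succ, eval_comb, eval_comb, hP, hR, hO]
      norm_cast
      simp
    have hR' : eval x y z (comb (-(2 * (c i : ℤ))) P (-1) R) = r (i + 1) := by
      rw [h.r_succ, eval_comb, hP, hR, zpow_neg, zpow_neg, zpow_one]
      norm_cast
    have hO' : eval x y z P = p (i + 1 - 1) := by rw [hP, add_sub_cancel_right]
    have hbad' : ∀ v ∈ nontrivial P R (c i) ++ bad, eval x y z v ≠ 1 := fun v hv =>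
      (List.mem_append.1 hv).elim (eval_ne_one_of_mem_nontrivial (by rwa [hP, hR])) (hbad v)
    simp only [check, Bool.and_eq_true] at hcheck
    rcases hm.1 with h' | h'
    · have hv : eval x y z (comb (c i + 1) P 0 R) = 1 := by
        rw [eval_comb, hP, zpow_zero, mul_one]
        exact_mod_cast h'.2
      rcases ih (hB.insert hv) hP' hR' hO' hbad' hw hcheck.2 with h₁ | h₁
      · exact Or.inl h₁
      · exact (Bool.false_ne_true h₁.1).elim
    · have hv : eval x y z (comb (c i) P 1 R) = 1 := by
        rw [eval_comb, hP, hR, zpow_one]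
        exact_mod_cast h'
      rcases ih (hB.insert hv) hP' hR' hO' hbad' hw hcheck.1 with h₁ | ⟨h₁, h₂⟩
      · exact Or.inl h₁
      · refine Or.inr ⟨h₁, fun j hj => ?_⟩
        cases j with
        | zero => simpa using h'
        | succ j =>
          have := h₂ j (by simpa using hj)
          rw [show i + 1 + (j : ℤ) = i + (j + 1 : ℕ) by push_cast; ring] at this
          exact this

lemma of_checkWord (h : ReflChain p r c) {Ns : List ℕ} {all : Bool} {w : List ℕ} {i : ℤ}
    (hw : ReadsAt c i w) (hcheck : checkWord Ns all w = true) :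
    (∃ N ∈ Ns, p i ^ N = 1 ∧ r i ^ N = 1 ∧ p (i - 1) ^ N = 1) ∨
      (all = true ∧ ∀ j < w.length, p (i + j) ^ c (i + j) * r (i + j) = 1) :=
  of_check h ⟨by simp [eval], by simp [eval], by simp [eval]⟩ (by simp [eval]) (by simp [eval])
    (by simp [eval]) (by simp) hw hcheck

end MonomialRelation

lemma relation_checkWord_keyWordData :
    ∀ x ∈ keyWordData, MonomialRelation.checkWord x.2.1 x.2.2 x.1 = true := by
  decide +kernel

lemma torsion_checkWord_keyWordData :
    ∀ x ∈ keyWordData, ∀ N ∈ x.2.1, 0 < N ∧ Torsion.checkWord N x.1 = true := by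
  decide +kernel

namespace ReflChain

section

variable {G : Type*} [CommGroup G] {p r : ℤ → G} {c : ℤ → ℕ} {i : ℤ}

lemma r_succ_of_pow_mul_eq_one (h : ReflChain p r c) (hi : p i ^ c i * r i = 1) :
    r (i + 1) = r i := by
  rw [h.r_succ, eq_inv_of_mul_eq_one_right hi, two_mul, pow_add]
  simp

lemma p_succ_of_pow_mul_eq_one (h : ReflChain p r c) (hi : p i ^ c i * r i = 1) :
    p (i + 1) = p (i - 1) := by
  rw [h.p_succ, pow_two, pow_mul, ← mul_pow, hi, one_pow, one_mul]

lemma c_succ_of_pow_mul_eq_one (h : ReflChain p r c) (hi : p i ^ c i * r i = 1) :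
    c (i + 1) = c (i - 1) := by
  refine (h.isMValue (i + 1)).unique ?_
  have := (h.isMValue (i - 1)).reflect
  rwa [← h.r_succ, sub_add_cancel, ← h.p_succ_of_pow_mul_eq_one hi,
    ← h.r_succ_of_pow_mul_eq_one hi] at this

end

variable {p r : ℤ → ℂˣ} {c : ℤ → ℕ} {i : ℤ}

lemma isRowlike_of_pow_mul_eq_one (h : ReflChain p r c) (hpos : ∀ n, 0 < walk c i 0 1 (n + 1))
    {w Ns : List ℕ} (hmem : (w, Ns, true) ∈ keyWordData) (hw : ReadsAt c i w)
    (hall : ∀ j < w.length, p (i + j) ^ c (i + j) * r (i + j) = 1) :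
    IsRowlike (p i) (r i) (p (i - 1)) := by
  have hw' : w = [1, 3, 1, 3] ∨ w = [3, 1, 3, 1] ∨ w = [1, 4, 1, 4, 1] ∨ w = [2, 2, 2, 2, 2, 2] := by
    have key : ∀ x ∈ keyWordData, x.2.2 = true → x.1 = [1, 3, 1, 3] ∨ x.1 = [3, 1, 3, 1] ∨
      x.1 = [1, 4, 1, 4, 1] ∨ x.1 = [2, 2, 2, 2, 2, 2] := by decide
    exact key _ hmem rfl
  have hlen : 1 < w.length := by rcases hw' with rfl | rfl | rfl | rfl <;> decide
  have h₀ := hall 0 (by omega)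
  have h₁ := hall 1 hlen
  rw [Nat.cast_zero, add_zero] at h₀
  rw [Nat.cast_one] at h₁
  have hp := h.p_succ_of_pow_mul_eq_one h₀
  have hr := h.r_succ_of_pow_mul_eq_one h₀
  have hwalk : w.length = 4 → c (i + 4) = c (i + 2) := fun hl => by
    have := h.c_succ_of_pow_mul_eq_one (hall 3 (by omega))
    rwa [Nat.cast_ofNat, add_assoc, add_sub_assoc] at this
  have hsix := hpos 5
  simp only [walk, Nat.cast_zero, Nat.cast_one, Nat.cast_ofNat, add_zero] at hsix
  rcases hw' with rfl | rfl | rfl | rfl <;>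
    simp only [ReadsAt, add_assoc, and_true, Int.reduceAdd] at hw
  · rw [hwalk rfl] at hsix
    simp [hw] at hsix
  · rw [hwalk rfl] at hsix
    simp [hw] at hsix
  · rw [hw.1, pow_one] at h₀
    rw [hw.2.1, hr] at h₁
    have hm := h.isMValue (i + 1)
    rw [hw.2.1] at hm
    rw [← hp]
    refine (isRowlike_of_quartic h₁ ?_ (hm.pow_ne_one ?_ ?_) (hm.pow_ne_one ?_ ?_)
      (hm.pow_ne_one ?_ ?_)).symm
    · rw [eq_inv_of_mul_eq_one_left h₀, eq_inv_of_mul_eq_one_left h₁]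
    all_goals norm_num
  · rw [hw.1] at h₀
    rw [hw.2.1, hr] at h₁
    have hm := h.isMValue i
    rw [hw.1] at hm
    rw [← hp]
    refine isRowlike_of_sq h₀ ?_ (hm.pow_ne_one ?_ ?_)
    · rw [eq_inv_of_mul_eq_one_left h₀, eq_inv_of_mul_eq_one_left h₁]
    all_goals norm_num

lemma isRowlike (h : ReflChain p r c) (hc : IsAffineSeq c) (i : ℤ) :
    IsRowlike (p i) (r i) (p (i - 1)) := by
  obtain ⟨T, s, hT⟩ := hc.exists_isTreeSeq
  obtain ⟨w, hw, k, hk⟩ := hT.exists_keyWord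
  obtain ⟨⟨w, Ns, all⟩, hmem, rfl⟩ := List.mem_map.1 hw
  refine h.transport (fun h => h.symm) (fun hm h => h.reflect hm) (i := k) ?_ i
  rcases MonomialRelation.of_checkWord h hk (relation_checkWord_keyWordData _ hmem) with
    ⟨N, hN, hp, hr, ho⟩ | ⟨rfl, hall⟩
  · have hcheck := torsion_checkWord_keyWordData _ hmem N hN
    have hne : ∀ x ∈ keyWordData, x.1 ≠ [] := by decide
    exact Torsion.isRowlike_of_checkWord h (hT.walk_pos k) (hne _ hmem) hk hcheck.1 hp hr ho
      hcheck.2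
  · exact h.isRowlike_of_pow_mul_eq_one (hT.walk_pos k) hmem hk hall

end ReflChain

/-- Classification of affine triples: up to exchanging `q₁` and `q₂`, every
affine triple appears in the list of Figure 2. -/
theorem affine_classification (q₁ q q₂ : ℂ) (h₁ : q₁ ≠ 0) (h : q ≠ 0) (h₂ : q₂ ≠ 0)
    (haff : AffineTriple (q₁, q, q₂)) :
    IsAffineRow (q₁, q, q₂) ∨ IsAffineRow (q₂, q, q₁) := by
  obtain ⟨Q, hQ, hQ₀, hc⟩ := haff
  obtain ⟨p, r, hchain, h₀⟩ := hQ.exists_reflChain (by rw [hQ₀]; exact ⟨h₁, h, h₂⟩)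
  rw [hQ₀] at h₀
  simp only [Prod.mk.injEq] at h₀
  obtain ⟨rfl, rfl, rfl⟩ := h₀
  exact hchain.isRowlike hc 0
end
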